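/- Let F(s) = ξ(2)·ξ(s+1)ξ(2s)/(s−2) − ξ(2)·ξ(s−1)ξ(2s−1)/(s+1) − ξ(s+1)ξ(2s)/(2s−2) + ξ(s−1)ξ(2s−1)/(2s) − ξ(s)ξ(2s)/((2s−2)(s+1)) − ξ(s)ξ(2s−1)/((2s)(s−2)). Then every zero of F lies on the central line: for every complex s with s ∉ {−1, 0, 1/2, 1, 2}, if F(s) = 0 then Re s = 1/2. -/

import Mathlib

open Complex

local notation "ξ" => completedRiemannZeta

/-- Weng's zeta function `ξ_{Sp(4);ℚ}(s) = ξ_ℚ^{Sp(4)/P_{e₁−e₂}}(s)`. -/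
noncomputable def wengSp4P1 (s : ℂ) : ℂ :=
  ξ 2 * ξ (s + 1) * ξ (2*s) / (s - 2)
    - ξ 2 * ξ (s - 1) * ξ (2*s - 1) / (s + 1)
    - ξ (s + 1) * ξ (2*s) / (2*s - 2)
    + ξ (s - 1) * ξ (2*s - 1) / (2*s)
    - ξ s * ξ (2*s) / ((2*s - 2) * (s + 1))
    - ξ s * ξ (2*s - 1) / ((2*s) * (s - 2))

namespace WengSp4

lemma one_le_evenKernel_zero {t : ℝ} (ht : 0 < t) : 1 ≤ HurwitzZeta.evenKernel 0 t := by
  have h := HurwitzZeta.hasSum_int_evenKernel 0 ht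
  have h1 := h.tsum_eq ▸ h.summable.le_tsum 0 (fun j _ => (Real.exp_pos _).le)
  simpa using h1

lemma exists_nonneg_mellin_kernel : ∃ g : ℝ → ℝ, (∀ t, 0 ≤ g t) ∧ ∀ s : ℂ,
    MeasureTheory.IntegrableOn (fun t : ℝ => (t : ℂ) ^ (s / 2 - 1) * (g t : ℂ)) (Set.Ioi 0) ∧
    completedRiemannZeta₀ s =
      (∫ t in Set.Ioi (0 : ℝ), (t : ℂ) ^ (s / 2 - 1) * (g t : ℂ)) / 2 := by
  have key : ∀ t, (0 ≤ ((HurwitzZeta.hurwitzEvenFEPair 0).f_modif t).re) ∧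
      (((HurwitzZeta.hurwitzEvenFEPair 0).f_modif t).re : ℂ) =
        (HurwitzZeta.hurwitzEvenFEPair 0).f_modif t := by
    intro t
    simp only [WeakFEPair.f_modif, Pi.add_apply]
    rcases lt_trichotomy t 1 with h1 | rfl | h1
    · rw [Set.indicator_of_notMem (by simp [h1.le])]
      by_cases h0 : 0 < t
      · rw [Set.indicator_of_mem (by simp [h0, h1])]
        have e := HurwitzZeta.evenKernel_functional_equation 0 t
        rw [← HurwitzZeta.evenKernel_eq_cosKernel_of_zero] at e
        have h2 := one_le_evenKernel_zero (one_div_pos.mpr h0)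
        have h3 : (0 : ℝ) < 1 / t ^ (1 / 2 : ℝ) := by positivity
        have h4 : t ^ (-(1 / 2) : ℝ) = 1 / t ^ (1 / 2 : ℝ) := by
          rw [Real.rpow_neg h0.le, ← one_div]
        have h5 : (0 : ℂ) + ((HurwitzZeta.hurwitzEvenFEPair 0).f t -
            ((HurwitzZeta.hurwitzEvenFEPair 0).ε *
              ((t ^ (-(HurwitzZeta.hurwitzEvenFEPair 0).k) : ℝ) : ℂ)) •
              (HurwitzZeta.hurwitzEvenFEPair 0).g₀) =
            ((HurwitzZeta.evenKernel 0 t - t ^ (-(1 / 2) : ℝ) : ℝ) : ℂ) := by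
          simp [HurwitzZeta.hurwitzEvenFEPair, Real.rpow_neg h0.le, one_div]
        rw [h5, ofReal_re]
        refine ⟨?_, rfl⟩
        rw [h4, e]
        nlinarith
      · rw [Set.indicator_of_notMem (by simp [h0])]; simp
    · simp
    · rw [Set.indicator_of_mem (by simpa using h1), Set.indicator_of_notMem (by simp [h1.le])]
      have h2 := one_le_evenKernel_zero (one_pos.trans h1)
      have h5 : (HurwitzZeta.hurwitzEvenFEPair 0).f t - (HurwitzZeta.hurwitzEvenFEPair 0).f₀ + 0 =
            ((HurwitzZeta.evenKernel 0 t - 1 : ℝ) : ℂ) := by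
          simp [HurwitzZeta.hurwitzEvenFEPair]
      rw [h5]
      simp [h2]
  refine ⟨fun t => ((HurwitzZeta.hurwitzEvenFEPair 0).f_modif t).re, fun t => (key t).1,
    fun s => ?_⟩
  have hm := (HurwitzZeta.hurwitzEvenFEPair 0).isStrongFEPair_toStrongFEPair.hasMellin (s / 2)
  constructor
  · have := hm.1
    simp only [MellinConvergent, WeakFEPair.toStrongFEPair, smul_eq_mul] at this
    simpa only [(key _).2] using this
  · simp only [(key _).2]
    rfl

lemma kernel_norm {g : ℝ → ℝ} (hg : ∀ t, 0 ≤ g t) (s : ℂ) :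
    Set.EqOn (fun t : ℝ => ‖(t : ℂ) ^ (s / 2 - 1) * (g t : ℂ)‖)
      (fun t : ℝ => t ^ (s.re / 2 - 1) * g t) (Set.Ioi 0) := by
  intro t ht
  simp only [norm_mul, norm_real, Real.norm_of_nonneg (hg t)]
  rw [norm_cpow_eq_rpow_re_of_pos ht]
  simp

/-- `completedRiemannZeta₀` on the real line. -/
noncomputable def J (x : ℝ) : ℝ := (completedRiemannZeta₀ x).re

lemma exists_real_kernel : ∃ g : ℝ → ℝ, (∀ t, 0 ≤ g t) ∧ (∀ x : ℝ,
    MeasureTheory.IntegrableOn (fun t : ℝ => t ^ (x / 2 - 1) * g t) (Set.Ioi 0) ∧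
    completedRiemannZeta₀ x = ((∫ t in Set.Ioi (0 : ℝ), t ^ (x / 2 - 1) * g t) / 2 : ℝ)) ∧
    ∀ s : ℂ, ‖completedRiemannZeta₀ s‖ ≤ (∫ t in Set.Ioi (0 : ℝ), t ^ (s.re / 2 - 1) * g t) / 2 := by
  obtain ⟨g, hg, h⟩ := exists_nonneg_mellin_kernel
  refine ⟨g, hg, fun x => ⟨?_, ?_⟩, fun s => ?_⟩
  · have := (h x).1.norm
    refine MeasureTheory.IntegrableOn.congr_fun this ?_ measurableSet_Ioi
    simpa using kernel_norm hg x
  · rw [(h x).2]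
    have : ∫ t in Set.Ioi (0 : ℝ), (t : ℂ) ^ ((x : ℂ) / 2 - 1) * (g t : ℂ) =
        ∫ t in Set.Ioi (0 : ℝ), ((t ^ (x / 2 - 1) * g t : ℝ) : ℂ) := by
      refine MeasureTheory.setIntegral_congr_fun measurableSet_Ioi fun t ht => ?_
      push_cast [ofReal_cpow (le_of_lt (Set.mem_Ioi.mp ht))]
      rfl
    rw [this, integral_complex_ofReal]
    push_cast
    rfl
  · rw [(h s).2, norm_div]
    simp only [norm_ofNat]
    gcongr
    refine (MeasureTheory.norm_integral_le_integral_norm _).trans_eq ?_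
    exact MeasureTheory.setIntegral_congr_fun measurableSet_Ioi (kernel_norm hg s)

lemma completedRiemannZeta₀_ofReal (x : ℝ) : completedRiemannZeta₀ x = J x := by
  obtain ⟨g, -, h, -⟩ := exists_real_kernel
  rw [J, (h x).2, ofReal_re]

lemma norm_completedRiemannZeta₀_le (s : ℂ) : ‖completedRiemannZeta₀ s‖ ≤ J s.re := by
  obtain ⟨g, -, h, h'⟩ := exists_real_kernel
  rw [J, (h s.re).2, ofReal_re]
  exact h' s

lemma J_nonneg (x : ℝ) : 0 ≤ J x := (norm_nonneg _).trans (norm_completedRiemannZeta₀_le (x : ℂ))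

lemma J_one_sub (x : ℝ) : J (1 - x) = J x := by
  rw [J, J]; push_cast; rw [completedRiemannZeta₀_one_sub]

lemma convexOn_J : ConvexOn ℝ Set.univ J := by
  obtain ⟨g, hg, h, -⟩ := exists_real_kernel
  refine ⟨convex_univ, fun x _ y _ a b ha hb hab => ?_⟩
  have e : ∀ x, J x = (∫ t in Set.Ioi (0 : ℝ), t ^ (x / 2 - 1) * g t) / 2 := fun x => by
    rw [J, (h x).2, ofReal_re]
  simp only [e, smul_eq_mul]
  rw [← mul_div_assoc, ← mul_div_assoc, ← add_div]
  gcongr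
  rw [← MeasureTheory.integral_const_mul, ← MeasureTheory.integral_const_mul,
    ← MeasureTheory.integral_add ((h x).1.const_mul a) ((h y).1.const_mul b)]
  refine MeasureTheory.setIntegral_mono_on (h _).1
    (((h x).1.const_mul a).add ((h y).1.const_mul b)) measurableSet_Ioi fun t ht => ?_
  have ht0 : 0 < t := ht
  have : t ^ ((a * x + b * y) / 2 - 1) ≤ a * t ^ (x / 2 - 1) + b * t ^ (y / 2 - 1) := by
    rw [Real.rpow_def_of_pos ht0, Real.rpow_def_of_pos ht0, Real.rpow_def_of_pos ht0]
    have := convexOn_exp.2 (Set.mem_univ (Real.log t * (x / 2 - 1)))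
      (Set.mem_univ (Real.log t * (y / 2 - 1))) ha hb hab
    simp only [smul_eq_mul] at this
    have e : Real.log t * ((a * x + b * y) / 2 - 1) =
        a * (Real.log t * (x / 2 - 1)) + b * (Real.log t * (y / 2 - 1)) := by
      linear_combination (Real.log t) * hab
    rwa [e]
  nlinarith [mul_le_mul_of_nonneg_right this (hg t)]

lemma J_mono {x y : ℝ} (hx : 1 / 2 ≤ x) (hxy : x ≤ y) : J x ≤ J y := by
  rcases hxy.eq_or_lt with rfl | hlt
  · rfl
  have hd : (0 : ℝ) < 2 * y - 1 := by linarith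
  have hd' := hd.ne'
  have := @convexOn_J.2 y (Set.mem_univ y) (1 - y) (Set.mem_univ (1 - y))
    ( (x + y - 1) / (2 * y - 1)) ((y - x) / (2 * y - 1))
    (div_nonneg (by linarith) hd.le) (div_nonneg (by linarith) hd.le)
    (by rw [← add_div, div_eq_one_iff_eq hd']; ring)
  rw [J_one_sub] at this
  simp only [smul_eq_mul] at this
  have e1 : (x + y - 1) / (2 * y - 1) * y + (y - x) / (2 * y - 1) * (1 - y) = x := by
    rw [div_mul_eq_mul_div, div_mul_eq_mul_div, ← add_div, div_eq_iff hd']; ring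
  have e2 : (x + y - 1) / (2 * y - 1) * J y + (y - x) / (2 * y - 1) * J y = J y := by
    rw [div_mul_eq_mul_div, div_mul_eq_mul_div, ← add_div, div_eq_iff hd']; ring
  rwa [e1, e2] at this

lemma completedRiemannZeta₀_conj (s : ℂ) :
    completedRiemannZeta₀ ((starRingEnd ℂ) s) = (starRingEnd ℂ) (completedRiemannZeta₀ s) := by
  obtain ⟨g, hg, h⟩ := exists_nonneg_mellin_kernel
  rw [(h s).2, (h _).2, map_div₀, ← integral_conj]
  simp only [map_ofNat]
  congr 1
  refine MeasureTheory.setIntegral_congr_fun measurableSet_Ioi fun t ht => ?_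
  simp only [map_mul, conj_ofReal]
  have e : (starRingEnd ℂ) s / 2 - 1 = (starRingEnd ℂ) (s / 2 - 1) := by simp [map_ofNat]
  rw [e, cpow_conj _ _ (by
    rw [arg_ofReal_of_nonneg (le_of_lt ht)]; exact Real.pi_pos.ne), conj_ofReal]

lemma norm_completedRiemannZeta₀_le_of_abs_le {R : ℝ} (s : ℂ) (hs : |s.re - 1 / 2| ≤ R - 1 / 2) :
    ‖completedRiemannZeta₀ s‖ ≤ J R := by
  refine (norm_completedRiemannZeta₀_le s).trans ?_
  obtain ⟨h1, h2⟩ := abs_le.mp hs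
  rcases le_total (1 / 2) s.re with h | h
  · exact J_mono h (by linarith)
  · rw [← J_one_sub]; exact J_mono (by linarith) (by linarith)

/-- The entire function `s (s - 1) ξ(s)`. -/
noncomputable def Xi (s : ℂ) : ℂ := s * (s - 1) * completedRiemannZeta₀ s + 1

lemma differentiable_Xi : Differentiable ℂ Xi := by
  have := differentiable_completedZeta₀
  unfold Xi
  fun_prop

@[fun_prop] lemma continuous_Xi : Continuous Xi := differentiable_Xi.continuous

lemma Xi_one_sub (s : ℂ) : Xi (1 - s) = Xi s := by
  rw [Xi, Xi, completedRiemannZeta₀_one_sub]; ring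

lemma Xi_conj (s : ℂ) : Xi ((starRingEnd ℂ) s) = (starRingEnd ℂ) (Xi s) := by
  simp [Xi, completedRiemannZeta₀_conj]

lemma norm_Xi_conj (s : ℂ) : ‖Xi ((starRingEnd ℂ) s)‖ = ‖Xi s‖ := by
  rw [Xi_conj, norm_conj]

lemma Xi_zero : Xi 0 = 1 := by simp [Xi]

lemma Xi_one : Xi 1 = 1 := by simp [Xi]

lemma Xi_eq {s : ℂ} (h0 : s ≠ 0) (h1 : s ≠ 1) : Xi s = s * (s - 1) * completedRiemannZeta s := by
  rw [Xi, completedRiemannZeta_eq]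
  have : 1 - s ≠ 0 := sub_ne_zero.mpr h1.symm
  field_simp
  ring

lemma completedRiemannZeta_eq_Gammaℝ_mul {s : ℂ} (h0 : 0 < s.re) :
    completedRiemannZeta s = Gammaℝ s * riemannZeta s := by
  rw [riemannZeta_def_of_ne_zero (by rintro rfl; simp at h0),
    mul_div_cancel₀ _ (Gammaℝ_ne_zero_of_re_pos h0)]

lemma Xi_ne_zero {s : ℂ} (hs : 1 ≤ s.re) : Xi s ≠ 0 := by
  by_cases h1 : s = 1
  · simp [h1, Xi_one]
  have h0 : s ≠ 0 := by rintro rfl; simp at hs; linarith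
  rw [Xi_eq h0 h1, completedRiemannZeta_eq_Gammaℝ_mul (by linarith)]
  exact mul_ne_zero (mul_ne_zero h0 (sub_ne_zero.mpr h1))
    (mul_ne_zero (Gammaℝ_ne_zero_of_re_pos (by linarith)) (riemannZeta_ne_zero_of_one_le_re hs))

lemma completedRiemannZeta_two : completedRiemannZeta 2 = (Real.pi / 6 : ℝ) := by
  rw [completedRiemannZeta_eq_Gammaℝ_mul (by simp), riemannZeta_two, Gammaℝ_def]
  have : (Real.pi : ℂ) ≠ 0 := by exact_mod_cast Real.pi_ne_zero
  rw [show (-2 / 2 : ℂ) = -1 by norm_num, show (2 / 2 : ℂ) = 1 by norm_num, Gamma_one, cpow_neg_one]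
  push_cast
  field_simp

lemma Xi_two : Xi 2 = (Real.pi / 3 : ℝ) := by
  rw [Xi_eq two_ne_zero (by norm_num), completedRiemannZeta_two]
  push_cast; ring

/-- `Xi` on the real line. -/
noncomputable def XiR (x : ℝ) : ℝ := x * (x - 1) * J x + 1

lemma Xi_ofReal (x : ℝ) : Xi x = XiR x := by
  rw [Xi, completedRiemannZeta₀_ofReal, XiR]; push_cast; ring

lemma norm_Xi_le {R : ℝ} (s : ℂ) (hs : |s.re - 1 / 2| ≤ R - 1 / 2) :
    ‖Xi s‖ ≤ ‖s‖ * ‖s - 1‖ * J R + 1 := by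
  unfold Xi
  refine (norm_add_le _ _).trans ?_
  rw [norm_mul, norm_mul, norm_one]
  gcongr
  exact norm_completedRiemannZeta₀_le_of_abs_le s hs

lemma J_two : J 2 = (Real.pi / 3 - 1) / 2 := by
  have := Xi_ofReal 2
  push_cast at this
  rw [Xi_two, ofReal_inj, XiR] at this
  linarith

lemma XiR_mono {x y : ℝ} (hx : 1 ≤ x) (hxy : x ≤ y) : XiR x ≤ XiR y := by
  unfold XiR
  have h1 := J_mono (by linarith) hxy
  have h2 := J_nonneg x
  have h3 : x * (x - 1) ≤ y * (y - 1) := by nlinarith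
  have h4 : 0 ≤ x * (x - 1) := by nlinarith
  nlinarith [mul_le_mul h3 h1 h2 (h4.trans h3)]

lemma one_le_XiR {x : ℝ} (hx : 1 ≤ x) : 1 ≤ XiR x := by
  have := XiR_mono le_rfl hx
  simpa [XiR] using this

lemma norm_le_one_of_re_half {f : ℂ → ℂ}
    (hd : ∀ s : ℂ, 1 / 2 ≤ s.re → DifferentiableAt ℂ f s)
    (hexp : ∃ A B R : ℝ, ∀ s : ℂ, 1 / 2 < s.re → R ≤ ‖s‖ → ‖f s‖ ≤ A * Real.exp (B * ‖s‖))
    (hre : ∃ A R : ℝ, ∀ x : ℝ, R ≤ x → ‖f x‖ ≤ A)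
    (him : ∀ s : ℂ, s.re = 1 / 2 → ‖f s‖ ≤ 1) {s : ℂ} (hs : 1 / 2 ≤ s.re) : ‖f s‖ ≤ 1 := by
  have hd' : ∀ w : ℂ, 0 ≤ w.re → DifferentiableAt ℂ (fun w => f (w + 1 / 2)) w := fun w hw => by
    have h1 : 1 / 2 ≤ (w + 1 / 2).re := by simpa using hw
    exact (hd _ h1).comp w (by fun_prop)
  have key := PhragmenLindelof.right_half_plane_of_bounded_on_real
    (f := fun w => f (w + 1 / 2)) (C := 1) (z := s - 1 / 2) ?_ ?_ ?_ ?_ (by simpa using hs)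
  · simpa using key
  · constructor
    · exact fun w hw => (hd' w (le_of_lt hw)).differentiableWithinAt
    · intro w hw
      rw [closure_setOfPred_lt_re] at hw
      exact (hd' w hw).continuousAt.continuousWithinAt
  · obtain ⟨A, B, R, h⟩ := hexp
    refine ⟨1, by norm_num, |B|, ?_⟩
    refine Asymptotics.IsBigO.of_bound (|A| * Real.exp (|B|)) ?_
    have hev : ∀ᶠ w in Bornology.cobounded ℂ, R + 1 ≤ ‖w‖ :=
      (tendsto_norm_cobounded_atTop (E := ℂ)).eventually_ge_atTop _
    filter_upwards [hev.filter_mono inf_le_left,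
      Filter.mem_inf_of_right (Filter.mem_principal_self _)] with w hw1 hw2
    have n1 : ‖w + 1 / 2‖ ≤ ‖w‖ + 1 := by
      refine (norm_add_le _ _).trans ?_
      norm_num
    have n2 : R ≤ ‖w + 1 / 2‖ := by
      have := norm_sub_le (w + 1 / 2) (1 / 2)
      norm_num at this
      linarith
    refine (h _ (by simpa using hw2) n2).trans ?_
    rw [Real.rpow_one, Real.norm_of_nonneg (Real.exp_pos _).le, mul_assoc, ← Real.exp_add]
    have : B * ‖w + 1 / 2‖ ≤ |B| + |B| * ‖w‖ := by
      have := mul_le_mul (le_abs_self B) n1 (norm_nonneg _) (abs_nonneg B)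
      linarith
    exact mul_le_mul (le_abs_self A) (Real.exp_le_exp.mpr this) (Real.exp_pos _).le (abs_nonneg A)
  · obtain ⟨A, R, h⟩ := hre
    refine ⟨A, ?_⟩
    rw [Filter.eventually_map]
    filter_upwards [Filter.eventually_ge_atTop R] with x hx
    have := h (x + 1 / 2) (by linarith)
    push_cast at this
    exact this
  · intro x
    exact him _ (by simp)

lemma exists_LSeries_bound {f : ℕ → ℂ} {σ : ℝ} (h : LSeriesSummable f σ) :
    ∃ C : ℝ, 0 < C ∧ ∀ s : ℂ, σ ≤ s.re → ‖LSeries f s‖ ≤ C := by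
  refine ⟨∑' n, ‖LSeries.term f σ n‖ + 1, ?_, fun s hs => ?_⟩
  · have : 0 ≤ ∑' n, ‖LSeries.term f σ n‖ := tsum_nonneg fun n => norm_nonneg _
    linarith
  · have h1 : ∀ n, ‖LSeries.term f s n‖ ≤ ‖LSeries.term f σ n‖ := fun n =>
      LSeries.norm_term_le_of_re_le_re f (by simpa using hs) n
    have h2 : Summable fun n => ‖LSeries.term f s n‖ :=
      Summable.of_nonneg_of_le (fun _ => norm_nonneg _) h1 h.norm
    unfold LSeries
    refine (norm_tsum_le_tsum_norm h2).trans ?_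
    have := h2.tsum_le_tsum h1 h.norm
    linarith

lemma exists_riemannZeta_bound : ∃ C : ℝ, 0 < C ∧ ∀ s : ℂ, 2 ≤ s.re → ‖riemannZeta s‖ ≤ C := by
  obtain ⟨C, hC, h⟩ := exists_LSeries_bound (f := 1) (σ := 2)
    (LSeriesSummable_one_iff.mpr (by norm_num))
  refine ⟨C, hC, fun s hs => ?_⟩
  rw [← LSeries_one_eq_riemannZeta (by linarith)]
  exact h s hs

lemma exists_riemannZeta_lower_bound {σ : ℝ} (hσ : 1 < σ) :
    ∃ C : ℝ, 0 < C ∧ ∀ s : ℂ, σ ≤ s.re → 1 ≤ C * ‖riemannZeta s‖ := by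
  obtain ⟨C, hC, h⟩ := exists_LSeries_bound (f := fun n => (ArithmeticFunction.moebius n : ℂ))
    (σ := σ) (ArithmeticFunction.LSeriesSummable_moebius_iff.mpr (by simpa using hσ))
  refine ⟨C, hC, fun s hs => ?_⟩
  have h1 := LSeries_one_mul_Lseries_moebius (s := s) (by linarith)
  rw [LSeries_one_eq_riemannZeta (by linarith)] at h1
  have h2 := congrArg norm h1
  rw [norm_mul, norm_one] at h2
  rw [← h2, mul_comm C]
  gcongr
  exact h s hs

lemma norm_Gamma_le_mul_norm_Gamma_add {a : ℂ} {δ : ℝ} (ha : 1 ≤ a.re) (hδ : 0 < δ) :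
    Real.Gamma δ * ‖Gamma a‖ ≤ ‖Gamma (a + δ)‖ * (1 / δ) := by
  have h := Gamma_mul_Gamma_eq_betaIntegral (s := a) (t := δ) (by linarith) (by simpa using hδ)
  have hb : ‖betaIntegral a δ‖ ≤ 1 / δ := by
    rw [betaIntegral_symm, betaIntegral]
    have e1 : ∫ x in (0 : ℝ)..1, x ^ (δ - 1) = 1 / δ := by
      rw [integral_rpow (Or.inl (by linarith))]
      simp [hδ.ne']
    rw [← e1]
    refine intervalIntegral.norm_integral_le_of_norm_le zero_le_one ?_
      (intervalIntegral.intervalIntegrable_rpow' (by linarith))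
    refine Filter.Eventually.of_forall fun x hx => ?_
    rw [norm_mul, norm_cpow_eq_rpow_re_of_pos hx.1]
    have h1 : ‖(1 - x : ℂ) ^ (a - 1)‖ ≤ 1 := by
      have h0 : (0 : ℝ) ≤ 1 - x := by linarith [hx.2]
      rw [show (1 - x : ℂ) = ((1 - x : ℝ) : ℂ) by push_cast; rfl]
      rcases h0.eq_or_lt with h0 | h0
      · rw [← h0, ofReal_zero]
        by_cases hz : a - 1 = 0
        · simp [hz]
        · simp [zero_cpow hz]
      · rw [norm_cpow_eq_rpow_re_of_pos h0]
        exact Real.rpow_le_one h0.le (by linarith [hx.1]) (by simpa using ha)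
    have h2 : 0 ≤ x ^ (δ - 1) := Real.rpow_nonneg hx.1.le _
    simpa using mul_le_mul_of_nonneg_left h1 h2
  have h2 := congrArg norm h
  rw [norm_mul, norm_mul, Gamma_ofReal, norm_real, Real.norm_of_nonneg (Real.Gamma_pos_of_pos hδ).le]
    at h2
  rw [mul_comm, h2]
  gcongr

lemma norm_Gamma_le_Gamma_re {s : ℂ} (hs : 0 < s.re) : ‖Gamma s‖ ≤ Real.Gamma s.re := by
  rw [Gamma_eq_integral hs, Real.Gamma_eq_integral hs, GammaIntegral]
  refine MeasureTheory.norm_integral_le_of_norm_le (Real.GammaIntegral_convergent hs) ?_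
  refine (MeasureTheory.ae_restrict_iff' measurableSet_Ioi).mpr
    (Filter.Eventually.of_forall fun x hx => ?_)
  rw [norm_mul, norm_cpow_eq_rpow_re_of_pos hx, norm_real, Real.norm_of_nonneg (Real.exp_pos _).le]
  simp

lemma norm_sin_le_exp (z : ℂ) : ‖sin z‖ ≤ Real.exp ‖z‖ := by
  rw [sin, norm_div, norm_mul, norm_I, mul_one, norm_ofNat, div_le_iff₀ two_pos]
  refine (norm_sub_le _ _).trans ?_
  have h1 := norm_exp_le_exp_norm (-z * I)
  have h2 := norm_exp_le_exp_norm (z * I)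
  simp only [norm_mul, norm_neg, norm_I, mul_one] at h1 h2
  linarith

lemma exists_one_le_norm_Gamma_mul_exp : ∃ C : ℝ, 0 < C ∧ ∀ w : ℂ, 1 / 2 ≤ w.re → w.re ≤ 3 →
    1 ≤ |w.im| → 1 ≤ C * Real.exp (Real.pi * ‖w‖) * ‖Gamma w‖ := by
  have hc : ContinuousOn Real.Gamma (Set.Icc 1 4) := fun x hx =>
    (Real.differentiableAt_Gamma fun m => by
      have := hx.1
      have : (0 : ℝ) ≤ m := m.cast_nonneg
      intro h; linarith).continuousAt.continuousWithinAt
  obtain ⟨K, hK⟩ := isCompact_Icc.exists_bound_of_continuousOn hc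
  refine ⟨|K| + 1, by positivity, fun w h1 h2 h3 => ?_⟩
  have hprod := Gamma_mul_Gamma_one_sub w
  have hne : ∀ z : ℂ, z.im = - w.im → z ≠ 0 := fun z hz h => by
    rw [h, zero_im] at hz
    rw [neg_eq_zero.mp hz.symm] at h3
    simp at h3
    linarith
  have hone : ∀ z : ℂ, z.im = - w.im → 1 ≤ ‖z‖ := fun z hz =>
    (by rw [hz, abs_neg]; exact h3 : 1 ≤ |z.im|).trans (abs_im_le_norm z)
  have g1 : Gamma (1 - w + 1) = (1 - w) * Gamma (1 - w) := Gamma_add_one _ (hne _ (by simp))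
  have g2 : Gamma (1 - w + 1 + 1) = (1 - w + 1) * Gamma (1 - w + 1) :=
    Gamma_add_one _ (hne _ (by simp))
  have g3 : Gamma (1 - w + 1 + 1 + 1) = (1 - w + 1 + 1) * Gamma (1 - w + 1 + 1) :=
    Gamma_add_one _ (hne _ (by simp))
  have b1 : ‖Gamma (1 - w)‖ ≤ |K| := by
    have e : ‖Gamma (1 - w + 1 + 1 + 1)‖ ≤ |K| := by
      refine (norm_Gamma_le_Gamma_re (by simp; linarith)).trans ((le_abs_self _).trans ?_)
      refine (hK _ ?_).trans (le_abs_self K)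
      simp only [add_re, sub_re, one_re, Set.mem_Icc]
      constructor <;> linarith
    rw [g3, g2, g1, norm_mul, norm_mul, norm_mul] at e
    have k1 := hone (1 - w) (by simp)
    have k2 := hone (1 - w + 1) (by simp)
    have k3 := hone (1 - w + 1 + 1) (by simp)
    refine le_trans ?_ e
    have := norm_nonneg (Gamma (1 - w))
    calc ‖Gamma (1 - w)‖ = 1 * (1 * (1 * ‖Gamma (1 - w)‖)) := by ring
      _ ≤ _ := by gcongr
  have hw : ‖Gamma w‖ * ‖Gamma (1 - w)‖ * ‖sin (Real.pi * w)‖ = Real.pi := by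
    have hs : sin (Real.pi * w) ≠ 0 := by
      intro h
      rw [h, div_zero] at hprod
      rcases mul_eq_zero.mp hprod with h | h
      · exact Gamma_ne_zero_of_re_pos (by linarith) h
      · rw [h, mul_zero] at g1
        rw [g1, mul_zero] at g2
        rw [g2, mul_zero] at g3
        exact Gamma_ne_zero_of_re_pos (by simp; linarith) g3
    rw [← norm_mul, ← norm_mul, hprod, div_mul_cancel₀ _ hs, norm_real,
      Real.norm_of_nonneg Real.pi_pos.le]
  have hsin := norm_sin_le_exp (Real.pi * w)
  rw [norm_mul, norm_real, Real.norm_of_nonneg Real.pi_pos.le] at hsin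
  have := Real.pi_gt_three
  calc (1 : ℝ) ≤ Real.pi := by linarith
    _ = ‖Gamma w‖ * ‖Gamma (1 - w)‖ * ‖sin (Real.pi * w)‖ := hw.symm
    _ ≤ ‖Gamma w‖ * (|K| + 1) * Real.exp (Real.pi * ‖w‖) := by
      gcongr
      linarith
    _ = _ := by ring

lemma norm_Xi_eq {s : ℂ} (hs : 1 < s.re) : ‖Xi s‖ =
    ‖s‖ * ‖s - 1‖ * (Real.pi ^ (-s.re / 2) * ‖Gamma (s / 2)‖ * ‖riemannZeta s‖) := by
  rw [Xi_eq (by rintro rfl; simp at hs; linarith) (by rintro rfl; simp at hs),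
    completedRiemannZeta_eq_Gammaℝ_mul (by linarith), Gammaℝ_def]
  simp only [norm_mul]
  rw [norm_cpow_eq_rpow_re_of_pos Real.pi_pos]
  simp

lemma norm_sub_ofReal_le {z : ℂ} {x : ℝ} (hz : 0 ≤ z.re) (hx : 0 ≤ x) : ‖z - x‖ ≤ ‖z + x‖ := by
  rw [← sq_le_sq₀ (norm_nonneg _) (norm_nonneg _), ← normSq_eq_norm_sq, ← normSq_eq_norm_sq,
    normSq_apply, normSq_apply]
  simp
  nlinarith [mul_nonneg hz hx]

lemma exists_norm_Xi_sub_le_right {δ : ℝ} (h0 : 1 / 2 < δ) (h1 : δ ≤ 1) : ∃ A : ℝ, 0 < A ∧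
    ∀ s : ℂ, 3 ≤ s.re → ‖Xi (s - δ)‖ ≤ A * ‖Xi (s + δ)‖ := by
  obtain ⟨C1, hC1, hz1⟩ := exists_riemannZeta_bound
  obtain ⟨C2, hC2, hz2⟩ := exists_riemannZeta_lower_bound (σ := 2) (by norm_num)
  have hδ : 0 < δ := by linarith
  have hG : 0 < Real.Gamma δ := Real.Gamma_pos_of_pos hδ
  have hpi : 0 < Real.pi := Real.pi_pos
  refine ⟨Real.pi ^ δ * ((1 / δ) / Real.Gamma δ) * C1 * C2, by positivity, fun s hs => ?_⟩
  rw [norm_Xi_eq (by simp; linarith), norm_Xi_eq (by simp; linarith)]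
  have e1 : ‖s - δ‖ ≤ ‖s + δ‖ := norm_sub_ofReal_le (by linarith) hδ.le
  have e2 : ‖s - δ - 1‖ ≤ ‖s + δ - 1‖ := by
    have := norm_sub_ofReal_le (z := s - 1) (x := δ) (by simp; linarith) hδ.le
    convert this using 2 <;> ring
  have e3 : Real.pi ^ (-(s - δ).re / 2) = Real.pi ^ δ * Real.pi ^ (-(s + δ).re / 2) := by
    rw [← Real.rpow_add hpi]
    congr 1
    simp; ring
  have e4 : ‖Gamma ((s - δ) / 2)‖ ≤ ((1 / δ) / Real.Gamma δ) * ‖Gamma ((s + δ) / 2)‖ := by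
    have := norm_Gamma_le_mul_norm_Gamma_add (a := (s - δ) / 2) (δ := δ) (by simp; linarith) hδ
    rw [show (s - δ) / 2 + δ = (s + δ) / 2 by ring] at this
    rw [div_mul_eq_mul_div, le_div_iff₀ hG]
    linarith
  have e5 : ‖riemannZeta (s - δ)‖ ≤ C1 * (C2 * ‖riemannZeta (s + δ)‖) := by
    have k1 := hz1 (s - δ) (by simp; linarith)
    have k2 := hz2 (s + δ) (by simp; linarith)
    nlinarith
  calc _ ≤ ‖s + δ‖ * ‖s + δ - 1‖ * ((Real.pi ^ δ * Real.pi ^ (-(s + δ).re / 2)) *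
        (((1 / δ) / Real.Gamma δ) * ‖Gamma ((s + δ) / 2)‖) *
        (C1 * (C2 * ‖riemannZeta (s + δ)‖))) := by
        rw [e3]; gcongr
    _ = _ := by ring

lemma exists_norm_Xi_sub_le_left {δ : ℝ} (h0 : 1 / 2 < δ) (h1 : δ ≤ 1) : ∃ A B : ℝ, 0 < A ∧
    0 < B ∧ ∀ s : ℂ, 1 / 2 < s.re → s.re ≤ 3 → 6 ≤ ‖s‖ →
      ‖Xi (s - δ)‖ ≤ A * Real.exp (B * ‖s‖) * ‖Xi (s + δ)‖ := by
  obtain ⟨C1, hC1, hG⟩ := exists_one_le_norm_Gamma_mul_exp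
  obtain ⟨C2, hC2, hz⟩ := exists_riemannZeta_lower_bound (σ := 1 / 2 + δ) (by linarith)
  have hpi : 0 < Real.pi := Real.pi_pos
  have hJ := J_nonneg 3
  refine ⟨(2 * J 3 + 1) * Real.pi ^ (2 : ℝ) * C1 * C2, 2 + Real.pi, by positivity, by positivity,
    fun s hs1 hs2 hs3 => ?_⟩
  have him : 2 ≤ |s.im| := by
    have := norm_le_abs_re_add_abs_im s
    rw [abs_of_pos (by linarith)] at this
    linarith
  have n1 : ‖s - δ‖ ≤ ‖s‖ + 1 := by
    refine (norm_sub_le _ _).trans ?_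
    rw [norm_real, Real.norm_of_nonneg (by linarith)]
    linarith
  have n1' : ‖s + δ‖ ≤ ‖s‖ + 1 := by
    refine (norm_add_le _ _).trans ?_
    rw [norm_real, Real.norm_of_nonneg (by linarith)]
    linarith
  have n2 : ‖s - δ - 1‖ ≤ ‖s‖ + 2 := by
    refine (norm_sub_le _ _).trans ?_
    rw [norm_one]
    linarith
  have hx : ‖s‖ + 1 ≤ Real.exp ‖s‖ := Real.add_one_le_exp _
  have up : ‖Xi (s - δ)‖ ≤ (2 * J 3 + 1) * Real.exp (2 * ‖s‖) := by
    refine (norm_Xi_le (R := 3) _ ?_).trans ?_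
    · simp only [sub_re, ofReal_re]
      rw [abs_le]; constructor <;> linarith
    · have : Real.exp (2 * ‖s‖) = Real.exp ‖s‖ * Real.exp ‖s‖ := by
        rw [← Real.exp_add]; ring_nf
      have k1 : ‖s - δ‖ * ‖s - δ - 1‖ ≤ Real.exp ‖s‖ * (2 * Real.exp ‖s‖) := by
        gcongr <;> linarith [norm_nonneg s]
      have k2 : 1 ≤ Real.exp (2 * ‖s‖) := Real.one_le_exp (by positivity)
      have k3 := mul_le_mul_of_nonneg_right k1 hJ
      rw [this] at k2 ⊢
      linarith
  have low : Real.exp (Real.pi * ‖s‖) * (Real.pi ^ (2 : ℝ) * C1 * C2) * ‖Xi (s + δ)‖ ≥ 1 := by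
    rw [norm_Xi_eq (by simp; linarith)]
    have k1 : 1 ≤ ‖s + δ‖ := by
      have := abs_im_le_norm (s + δ)
      simp at this; linarith
    have k2 : 1 ≤ ‖s + δ - 1‖ := by
      have := abs_im_le_norm (s + δ - 1)
      simp at this; linarith
    have k3 : Real.pi ^ (-(2 : ℝ)) ≤ Real.pi ^ (-(s + δ).re / 2) := by
      refine Real.rpow_le_rpow_of_exponent_le (by linarith [Real.pi_gt_three]) ?_
      simp; linarith
    have k4 := hG ((s + δ) / 2) (by simp; linarith) (by simp; linarith) (by
      simp only [div_ofNat_im, add_im, ofReal_im, add_zero, abs_div, abs_two]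
      linarith)
    have k5 := hz (s + δ) (by simp; linarith)
    have k6 : ‖(s + δ) / 2‖ ≤ ‖s‖ := by
      rw [norm_div, norm_ofNat]; linarith
    have k7 : 1 ≤ C1 * Real.exp (Real.pi * ‖s‖) * ‖Gamma ((s + δ) / 2)‖ :=
      k4.trans (by gcongr)
    have k8 : 1 ≤ Real.pi ^ (2 : ℝ) * Real.pi ^ (-(s + δ).re / 2) := by
      have : Real.pi ^ (2 : ℝ) * Real.pi ^ (-(2 : ℝ)) = 1 := by
        rw [← Real.rpow_add hpi]; simp
      rw [← this]; gcongr
    calc (1 : ℝ) = 1 * 1 * 1 * 1 * 1 := by norm_num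
      _ ≤ ‖s + δ‖ * ‖s + δ - 1‖ * (Real.pi ^ (2 : ℝ) * Real.pi ^ (-(s + δ).re / 2)) *
        (C1 * Real.exp (Real.pi * ‖s‖) * ‖Gamma ((s + δ) / 2)‖) *
        (C2 * ‖riemannZeta (s + δ)‖) := by gcongr
      _ = _ := by ring
  calc ‖Xi (s - δ)‖ ≤ (2 * J 3 + 1) * Real.exp (2 * ‖s‖) * 1 := by rw [mul_one]; exact up
    _ ≤ (2 * J 3 + 1) * Real.exp (2 * ‖s‖) *
      (Real.exp (Real.pi * ‖s‖) * (Real.pi ^ (2 : ℝ) * C1 * C2) * ‖Xi (s + δ)‖) := by gcongr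
    _ = (2 * J 3 + 1) * (Real.exp (2 * ‖s‖) * Real.exp (Real.pi * ‖s‖)) *
      (Real.pi ^ (2 : ℝ) * C1 * C2) * ‖Xi (s + δ)‖ := by ring
    _ = _ := by rw [← Real.exp_add]; ring_nf

lemma norm_Xi_sub_le_of_gt {δ : ℝ} (h0 : 1 / 2 < δ) (h1 : δ ≤ 1) {s : ℂ} (hs : 1 / 2 ≤ s.re) :
    ‖Xi (s - δ)‖ ≤ ‖Xi (s + δ)‖ := by
  have hne : ∀ s : ℂ, 1 / 2 ≤ s.re → Xi (s + δ) ≠ 0 := fun s hs =>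
    Xi_ne_zero (by simp; linarith)
  have key := norm_le_one_of_re_half (f := fun s => Xi (s - δ) / Xi (s + δ)) ?_ ?_ ?_ ?_ hs
  · rwa [norm_div, div_le_one (norm_pos_iff.mpr (hne s hs))] at key
  · intro s hs
    have := differentiable_Xi
    exact DifferentiableAt.div (by fun_prop) (by fun_prop) (hne s hs)
  · obtain ⟨A, hA, hr⟩ := exists_norm_Xi_sub_le_right h0 h1
    obtain ⟨A', B, hA', hB, hl⟩ := exists_norm_Xi_sub_le_left h0 h1
    refine ⟨A + A', B, 6, fun s hs1 hs2 => ?_⟩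
    rw [norm_div, div_le_iff₀ (norm_pos_iff.mpr (hne s hs1.le))]
    have he : 1 ≤ Real.exp (B * ‖s‖) := Real.one_le_exp (by positivity)
    rcases le_total s.re 3 with h | h
    · refine (hl s hs1 h hs2).trans ?_
      gcongr
      linarith
    · refine (hr s h).trans ?_
      gcongr
      nlinarith
  · refine ⟨1, 2, fun x hx => ?_⟩
    rw [show (x : ℂ) - δ = ((x - δ : ℝ) : ℂ) by push_cast; rfl,
      show (x : ℂ) + δ = ((x + δ : ℝ) : ℂ) by push_cast; rfl, Xi_ofReal, Xi_ofReal, norm_div,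
      norm_real, norm_real, Real.norm_of_nonneg, Real.norm_of_nonneg, div_le_one]
    · exact XiR_mono (by linarith) (by linarith)
    · linarith [one_le_XiR (x := x + δ) (by linarith)]
    · linarith [one_le_XiR (x := x + δ) (by linarith)]
    · linarith [one_le_XiR (x := x - δ) (by linarith)]
  · intro s hs
    have : s - δ = 1 - (starRingEnd ℂ) (s + δ) := by
      apply Complex.ext
      · simp; linarith
      · simp
    rw [this, Xi_one_sub, Xi_conj, norm_div, norm_conj, div_self]
    exact norm_ne_zero_iff.mpr (hne s hs.ge)

lemma norm_Xi_le_norm_Xi_add_one {s : ℂ} (hs : 0 ≤ s.re) : ‖Xi s‖ ≤ ‖Xi (s + 1)‖ := by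
  have hlim : ∀ c : ℝ, Filter.Tendsto (fun δ : ℝ => ‖Xi (s + 1 / 2 + c * δ)‖)
      (nhdsWithin (1 / 2) (Set.Ioi (1 / 2))) (nhds ‖Xi (s + 1 / 2 + c * (1 / 2 : ℝ))‖) := by
    intro c
    have : Continuous (fun δ : ℝ => ‖Xi (s + 1 / 2 + c * δ)‖) := by fun_prop
    exact (this.tendsto _).mono_left nhdsWithin_le_nhds
  have := le_of_tendsto_of_tendsto (hlim (-1)) (hlim 1) ?_
  · rw [show s + 1 / 2 + ((-1 : ℝ) : ℂ) * ((1 / 2 : ℝ) : ℂ) = s by push_cast; ring,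
      show s + 1 / 2 + ((1 : ℝ) : ℂ) * ((1 / 2 : ℝ) : ℂ) = s + 1 by push_cast; ring] at this
    exact this
  · filter_upwards [Ioc_mem_nhdsGT (show (1 / 2 : ℝ) < 1 by norm_num)] with δ hδ
    have := norm_Xi_sub_le_of_gt hδ.1 hδ.2 (s := s + 1 / 2) (by simp; linarith)
    rw [show s + 1 / 2 + ((-1 : ℝ) : ℂ) * (δ : ℂ) = s + 1 / 2 - δ by push_cast; ring,
      show s + 1 / 2 + ((1 : ℝ) : ℂ) * (δ : ℂ) = s + 1 / 2 + δ by push_cast; ring]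
    exact this

lemma norm_Xi_sub_one_le {s : ℂ} (hs : 1 / 2 ≤ s.re) : ‖Xi (s - 1)‖ ≤ ‖Xi (s + 1)‖ := by
  have := norm_Xi_sub_le_of_gt (δ := 1) (by norm_num) le_rfl hs
  simpa using this

lemma norm_add_conj_sq (a b : ℂ) :
    ‖a + (starRingEnd ℂ) b‖ ^ 2 = ‖a - b‖ ^ 2 + 4 * a.re * b.re := by
  rw [← normSq_eq_norm_sq, ← normSq_eq_norm_sq, normSq_apply, normSq_apply]
  simp
  ring

lemma re_sub_div_add_conj {a b : ℂ} (ha : 0 < a.re) (hb : 0 < b.re) :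
    ‖(a - b) / (a + (starRingEnd ℂ) b)‖ < 1 := by
  have h := norm_add_conj_sq a b
  have h2 : ‖a - b‖ < ‖a + (starRingEnd ℂ) b‖ := by
    rw [← sq_lt_sq₀ (norm_nonneg _) (norm_nonneg _), h]
    have := mul_pos ha hb
    linarith
  rw [norm_div, div_lt_one ((norm_nonneg _).trans_lt h2)]
  exact h2

lemma add_conj_ne_zero {a b : ℂ} (ha : 0 < a.re) (hb : 0 ≤ b.re) :
    a + (starRingEnd ℂ) b ≠ 0 := fun h => by
  have := congrArg re h
  simp at this
  linarith

/-- The Schwarz-Pick inequality for self-maps of the right half-plane. -/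
lemma schwarz_pick_of_pos {f : ℂ → ℂ} (hd : DifferentiableOn ℂ f {z | 0 < z.re})
    (hf : ∀ z : ℂ, 0 < z.re → 0 < (f z).re) {z w : ℂ} (hz : 0 < z.re) (hw : 0 < w.re) :
    ‖f z - f w‖ * ‖z + (starRingEnd ℂ) w‖ ≤ ‖z - w‖ * ‖f z + (starRingEnd ℂ) (f w)‖ := by
  set φ : ℂ → ℂ := fun ζ => (w + (starRingEnd ℂ) w * ζ) / (1 - ζ) with hφ
  have hne : ∀ ζ : ℂ, ζ ∈ Metric.ball (0 : ℂ) 1 → 1 - ζ ≠ 0 := fun ζ hζ h => by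
    rw [← sub_eq_zero.mp h] at hζ
    simp at hζ
  have hφre : ∀ ζ ∈ Metric.ball (0 : ℂ) 1, 0 < (φ ζ).re := by
    intro ζ hζ
    have h1 := hne ζ hζ
    have h2 : 0 < normSq (1 - ζ) := normSq_pos.mpr h1
    have h3 : (φ ζ).re = w.re * (1 - normSq ζ) / normSq (1 - ζ) := by
      simp only [hφ, div_re, normSq_apply]
      field_simp
      simp
      ring
    rw [h3]
    have h4 : normSq ζ < 1 := by
      rw [normSq_eq_norm_sq]
      have : ‖ζ‖ < 1 := by simpa using hζ
      have := norm_nonneg ζ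
      nlinarith
    have : 0 < 1 - normSq ζ := by linarith
    positivity
  set h : ℂ → ℂ := fun ζ => (f (φ ζ) - f w) / (f (φ ζ) + (starRingEnd ℂ) (f w)) with hh
  have hφd : DifferentiableOn ℂ φ (Metric.ball 0 1) := by
    intro ζ hζ
    have := hne ζ hζ
    exact (DifferentiableAt.div (by fun_prop) (by fun_prop) this).differentiableWithinAt
  have hfφ : DifferentiableOn ℂ (fun ζ => f (φ ζ)) (Metric.ball 0 1) := hd.comp hφd hφre
  have hhd : DifferentiableOn ℂ h (Metric.ball 0 1) :=
    (hfφ.sub_const _).div (hfφ.add_const _)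
      fun ζ hζ => add_conj_ne_zero (hf _ (hφre ζ hζ)) (hf w hw).le
  have hmaps : Set.MapsTo h (Metric.ball 0 1) (Metric.ball 0 1) := by
    intro ζ hζ
    rw [mem_ball_zero_iff]
    exact re_sub_div_add_conj (hf _ (hφre ζ hζ)) (hf w hw)
  have h0 : h 0 = 0 := by simp [hh, hφ]
  have hlt := re_sub_div_add_conj hz hw
  have hzw := add_conj_ne_zero hz hw.le
  have key := Complex.norm_le_norm_of_mapsTo_ball hhd (hmaps.mono_right Metric.ball_subset_closedBall) h0 hlt
  have hφz : φ ((z - w) / (z + (starRingEnd ℂ) w)) = z := by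
    simp only [hφ]
    have h5 := hne ((z - w) / (z + (starRingEnd ℂ) w)) (by simpa using hlt)
    rw [div_eq_iff h5]
    field_simp
    ring
  have hfz := add_conj_ne_zero (hf z hz) (hf w hw).le
  simp only [hh, hφz] at key
  rw [norm_div, norm_div, div_le_div_iff₀ (norm_pos_iff.mpr hfz) (norm_pos_iff.mpr hzw)] at key
  exact key

lemma schwarz_pick {f : ℂ → ℂ} (hd : DifferentiableOn ℂ f {z | 0 < z.re})
    (hf : ∀ z : ℂ, 0 < z.re → 0 ≤ (f z).re) {z w : ℂ} (hz : 0 < z.re) (hw : 0 < w.re) :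
    ‖f z - f w‖ * ‖z + (starRingEnd ℂ) w‖ ≤ ‖z - w‖ * ‖f z + (starRingEnd ℂ) (f w)‖ := by
  have hlim : Filter.Tendsto
      (fun δ : ℝ => ‖z - w‖ * ‖f z + (δ : ℂ) + (starRingEnd ℂ) (f w + (δ : ℂ))‖)
      (nhdsWithin 0 (Set.Ioi 0))
      (nhds (‖z - w‖ * ‖f z + ((0 : ℝ) : ℂ) + (starRingEnd ℂ) (f w + ((0 : ℝ) : ℂ))‖)) := by
    have : Continuous
      (fun δ : ℝ => ‖z - w‖ * ‖f z + (δ : ℂ) + (starRingEnd ℂ) (f w + (δ : ℂ))‖) := by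
      have := Complex.continuous_conj
      fun_prop
    exact (this.tendsto 0).mono_left nhdsWithin_le_nhds
  have := ge_of_tendsto hlim (b := ‖f z - f w‖ * ‖z + (starRingEnd ℂ) w‖) (by
    filter_upwards [self_mem_nhdsWithin] with δ hδ
    have := schwarz_pick_of_pos (f := fun z => f z + (δ : ℂ)) (hd.add_const _)
      (fun z hz => by
        have := hf z hz
        have : 0 < δ := hδ
        simp; linarith) hz hw
    simpa using this)
  simpa using this

lemma re_mul_re_le_of_schwarz_pick {f : ℂ → ℂ} (hd : DifferentiableOn ℂ f {z | 0 < z.re})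
    (hf : ∀ z : ℂ, 0 < z.re → 0 ≤ (f z).re) {z w : ℂ} (hz : 0 < z.re) (hw : 0 < w.re) :
    z.re * w.re * ‖f z + (starRingEnd ℂ) (f w)‖ ^ 2 ≤
      (f z).re * (f w).re * ‖z + (starRingEnd ℂ) w‖ ^ 2 := by
  have h := schwarz_pick hd hf hz hw
  have h2 := pow_le_pow_left₀ (by positivity) h 2
  rw [mul_pow, mul_pow] at h2
  have e1 := norm_add_conj_sq (f z) (f w)
  have e2 := norm_add_conj_sq z w
  have e3 : ‖f z - f w‖ ^ 2 = ‖f z + (starRingEnd ℂ) (f w)‖ ^ 2 - 4 * (f z).re * (f w).re := by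
    linarith
  have e4 : ‖z - w‖ ^ 2 = ‖z + (starRingEnd ℂ) w‖ ^ 2 - 4 * z.re * w.re := by linarith
  rw [e3, e4] at h2
  linarith

/-- The boundary version of the Schwarz-Pick inequality at the origin. -/
lemma julia {f : ℂ → ℂ} (hd : DifferentiableOn ℂ f {z | 0 < z.re})
    (hf : ∀ z : ℂ, 0 < z.re → 0 ≤ (f z).re) {y : ℝ}
    (hf' : HasDerivAt f y 0) (hf0 : f 0 = 0) {s : ℂ} (hs : 0 < s.re) :
    s.re * ‖f s‖ ^ 2 ≤ (f s).re * y * ‖s‖ ^ 2 := by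
  have hx : Filter.Tendsto (fun x : ℝ => (x : ℂ)) (nhdsWithin 0 (Set.Ioi 0)) (nhdsWithin 0 {0}ᶜ) := by
    refine tendsto_nhdsWithin_iff.mpr ⟨?_, ?_⟩
    · exact (Complex.continuous_ofReal.tendsto' 0 0 (by simp)).mono_left nhdsWithin_le_nhds
    · filter_upwards [self_mem_nhdsWithin] with x hx
      simpa using (ne_of_gt hx)
  have h1 := hf'.tendsto_slope.comp hx
  have h1' : Filter.Tendsto (fun x : ℝ => (f x).re / x) (nhdsWithin 0 (Set.Ioi 0)) (nhds y) := by
    have := (Complex.continuous_re.tendsto (y : ℂ)).comp h1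
    rw [ofReal_re] at this
    refine this.congr fun x => ?_
    simp [slope, hf0, ← ofReal_inv, div_eq_inv_mul]
  have h2 : Filter.Tendsto (fun x : ℝ => f x) (nhdsWithin 0 (Set.Ioi 0)) (nhds 0) := by
    have := hf'.continuousAt.tendsto.comp (hx.mono_right nhdsWithin_le_nhds)
    rwa [hf0] at this
  have h3 : Filter.Tendsto (fun x : ℝ => s.re * ‖f s + (starRingEnd ℂ) (f x)‖ ^ 2)
      (nhdsWithin 0 (Set.Ioi 0)) (nhds (s.re * ‖f s + (starRingEnd ℂ) 0‖ ^ 2)) :=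
    (((((Complex.continuous_conj.tendsto 0).comp h2).const_add (f s)).norm.pow 2).const_mul s.re)
  have h4 : Filter.Tendsto (fun x : ℝ => (f s).re * ((f x).re / x) * ‖s + (starRingEnd ℂ) x‖ ^ 2)
      (nhdsWithin 0 (Set.Ioi 0)) (nhds ((f s).re * y * ‖s + (starRingEnd ℂ) ((0 : ℝ) : ℂ)‖ ^ 2)) := by
    refine (h1'.const_mul _).mul ?_
    have : Continuous (fun x : ℝ => ‖s + (starRingEnd ℂ) (x : ℂ)‖ ^ 2) := by
      have := Complex.continuous_conj
      fun_prop
    exact (this.tendsto 0).mono_left nhdsWithin_le_nhds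
  have := le_of_tendsto_of_tendsto h3 h4 (by
    filter_upwards [self_mem_nhdsWithin] with x hx
    have hx : 0 < x := hx
    have k := re_mul_re_le_of_schwarz_pick hd hf hs (w := (x : ℂ)) (by simpa using hx)
    rw [ofReal_re] at k
    rw [← mul_le_mul_iff_right₀ hx]
    have e : x * ((f s).re * ((f x).re / x) * ‖s + (starRingEnd ℂ) x‖ ^ 2) =
        (f s).re * (f x).re * ‖s + (starRingEnd ℂ) x‖ ^ 2 := by
      field_simp
    rw [e]
    linarith)
  simpa using this

lemma re_one_sub_div_one_add_pos {b : ℂ} (hb : ‖b‖ < 1) : 0 < ((1 - b) / (1 + b)).re := by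
  have h1 : 1 + b ≠ 0 := fun h => by
    rw [eq_neg_of_add_eq_zero_right h] at hb
    simp at hb
  have h2 : 0 < normSq (1 + b) := normSq_pos.mpr h1
  have h3 : ((1 - b) / (1 + b)).re = (1 - normSq b) / normSq (1 + b) := by
    rw [div_re, normSq_apply, normSq_apply]
    rw [normSq_apply] at h2
    field_simp
    simp
    ring
  rw [h3]
  have : normSq b < 1 := by
    rw [normSq_eq_norm_sq]
    nlinarith [norm_nonneg b]
  exact div_pos (by linarith) h2

/-- For a self-map `B` of the disc type on the right half-plane with `B 0 = 1`, the Cayley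
transform `(1 + B) / (1 - B)` exceeds its polar part at the origin in real part. -/
lemma re_cayley_sub_nonneg {B : ℂ → ℂ} (hd : DifferentiableOn ℂ B {z | 0 < z.re})
    (hB : ∀ z : ℂ, 0 < z.re → ‖B z‖ < 1) {y : ℝ} (hB' : HasDerivAt B (-2 * y) 0) (hB0 : B 0 = 1) :
    0 < y ∧ ∀ s : ℂ, 0 < s.re → 0 ≤ ((1 + B s) / (1 - B s) - 1 / (y * s)).re := by
  have hne : ∀ z : ℂ, 0 < z.re → 1 + B z ≠ 0 := fun z hz h => by
    have := hB z hz
    rw [eq_neg_of_add_eq_zero_right h] at this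
    simp at this
  have hne' : ∀ z : ℂ, 0 < z.re → 1 - B z ≠ 0 := fun z hz h => by
    have := hB z hz
    rw [← sub_eq_zero.mp h] at this
    simp at this
  have hder : HasDerivAt (fun z => (1 - B z) / (1 + B z)) y 0 := by
    have := (hB'.const_sub 1).div (hB'.const_add 1) (by rw [hB0]; norm_num)
    refine this.congr_deriv ?_
    rw [hB0]; ring
  have J := fun s hs => julia (f := fun z => (1 - B z) / (1 + B z))
    (fun z hz => ((hd z hz).const_sub 1).div ((hd z hz).const_add 1) (hne z hz))
    (fun z hz => (re_one_sub_div_one_add_pos (hB z hz)).le) hder (by simp [hB0]) (s := s) hs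
  have hpos : ∀ s : ℂ, 0 < s.re → 0 < s.re * ‖(1 - B s) / (1 + B s)‖ ^ 2 := fun s hs => by
    have := norm_pos_iff.mpr (div_ne_zero (hne' s hs) (hne s hs))
    positivity
  have hy : 0 < y := by
    have h1 := (hpos 1 (by simp)).trans_le (J 1 (by simp))
    have h2 := re_one_sub_div_one_add_pos (hB 1 (by simp))
    simp only [norm_one, one_pow, mul_one] at h1
    exact (pos_iff_pos_of_mul_pos h1).mp h2
  refine ⟨hy, fun s hs => ?_⟩
  have h := J s hs
  set f := (1 - B s) / (1 + B s) with hf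
  have hf0 : f ≠ 0 := div_ne_zero (hne' s hs) (hne s hs)
  have hs0 : s ≠ 0 := by rintro rfl; simp at hs
  have e : (1 + B s) / (1 - B s) = f⁻¹ := by rw [hf, inv_div]
  rw [e, sub_re, inv_re, one_div, mul_inv, ← ofReal_inv, re_ofReal_mul, inv_re, sub_nonneg,
    normSq_eq_norm_sq, normSq_eq_norm_sq]
  have n1 := norm_pos_iff.mpr hf0
  have n2 := norm_pos_iff.mpr hs0
  rw [inv_mul_eq_div, div_div, div_le_div_iff₀ (by positivity) (by positivity)]
  linarith

lemma eulerMascheroniConstant_le_harmonic_sub_log (n : ℕ) :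
    Real.eulerMascheroniConstant ≤ harmonic n - Real.log (n + 1 / 2) := by
  have hanti : Antitone fun n : ℕ => (harmonic n : ℝ) - Real.log (n + 1 / 2) := by
    refine antitone_nat_of_succ_le fun n => ?_
    have hn : (0 : ℝ) < n + 1 / 2 := by positivity
    have h := Real.le_log_one_add_of_nonneg (x := 1 / (n + 1 / 2 : ℝ)) (by positivity)
    have e1 : (1 : ℝ) + 1 / (n + 1 / 2) = ((n + 1 : ℕ) + 1 / 2) / (n + 1 / 2) := by
      push_cast; field_simp; ring
    have e2 : 2 * (1 / (n + 1 / 2 : ℝ)) / (1 / (n + 1 / 2) + 2) = 1 / (n + 1) := by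
      field_simp; ring
    rw [e1, Real.log_div (by positivity) hn.ne', e2] at h
    rw [harmonic_succ]
    push_cast at h ⊢
    rw [one_div ((n : ℝ) + 1)] at h
    linarith
  have hlim : Filter.Tendsto (fun n : ℕ => (harmonic n : ℝ) - Real.log (n + 1 / 2)) Filter.atTop
      (nhds Real.eulerMascheroniConstant) := by
    refine tendsto_of_tendsto_of_tendsto_of_le_of_le' Real.tendsto_eulerMascheroniSeq
      Real.tendsto_eulerMascheroniSeq' ?_ ?_
    · refine Filter.Eventually.of_forall fun n => ?_
      simp only [Real.eulerMascheroniSeq]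
      gcongr
      norm_num
    · filter_upwards [Filter.eventually_gt_atTop 0] with n hn
      simp only [Real.eulerMascheroniSeq', hn.ne', if_false]
      have : (0 : ℝ) < n := by exact_mod_cast hn
      gcongr
      linarith
  exact hanti.le_of_tendsto hlim n

lemma norm_lt_one_of_re_pos {f : ℂ → ℂ} (hd : DifferentiableOn ℂ f {z | 0 < z.re})
    (hf : ∀ z : ℂ, 0 < z.re → ‖f z‖ ≤ 1) (hc : ContinuousAt f 0) (hf0 : f 0 = 1) {a : ℂ}
    (ha : 0 < a.re) (hfa : f a ≠ 1) {z : ℂ} (hz : 0 < z.re) : ‖f z‖ < 1 := by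
  refine (hf z hz).lt_of_ne fun heq => hfa ?_
  have hpre : IsPreconnected {z : ℂ | 0 < z.re} := (convex_halfSpace_re_gt 0).isPreconnected
  have hopen : IsOpen {z : ℂ | 0 < z.re} := isOpen_lt continuous_const continuous_re
  have hmax : IsMaxOn (norm ∘ f) {z | 0 < z.re} z := fun w hw => by
    simp only [Set.mem_ofPred_eq, Function.comp_apply, heq]
    exact hf w hw
  have h := Complex.eqOn_of_isPreconnected_of_isMaxOn_norm hpre hopen hd hz hmax
  have hx : Filter.Tendsto (fun x : ℝ => (x : ℂ)) (nhdsWithin 0 (Set.Ioi 0)) (nhds 0) :=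
    (Complex.continuous_ofReal.tendsto' 0 0 (by simp)).mono_left nhdsWithin_le_nhds
  have h1 : Filter.Tendsto (fun x : ℝ => f x) (nhdsWithin 0 (Set.Ioi 0)) (nhds 1) := by
    have := hc.tendsto.comp hx
    rwa [hf0] at this
  have h2 : Filter.Tendsto (fun x : ℝ => f x) (nhdsWithin 0 (Set.Ioi 0)) (nhds (f z)) := by
    refine tendsto_const_nhds.congr' ?_
    filter_upwards [self_mem_nhdsWithin] with x hx
    exact (h (show 0 < ((x : ℂ)).re by simpa using hx)).symm
  have h3 : f a = f z := h ha
  rw [h3]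
  exact tendsto_nhds_unique h2 h1

lemma hasDerivAt_Xi_one : HasDerivAt Xi (J 1) 1 := by
  have h := ((((hasDerivAt_id (1 : ℂ)).mul ((hasDerivAt_id (1 : ℂ)).sub_const 1))).mul
    (differentiable_completedZeta₀ 1).hasDerivAt).add_const 1
  refine (h.congr_deriv ?_)
  have := completedRiemannZeta₀_ofReal 1
  push_cast at this
  simp [this]

lemma hasDerivAt_Xi_zero : HasDerivAt Xi (-J 1) 0 := by
  have h1 : HasDerivAt Xi (J 1) (1 - 0) := by rw [sub_zero]; exact hasDerivAt_Xi_one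
  have h := h1.comp (0 : ℂ) ((hasDerivAt_id (0 : ℂ)).const_sub 1)
  refine (h.congr_of_eventuallyEq (.of_forall fun s => ?_)).congr_deriv (by simp)
  exact (Xi_one_sub s).symm

/-- The quotient `Xi s / Xi (s + 1)`. -/
noncomputable def Q (s : ℂ) : ℂ := Xi s / Xi (s + 1)

lemma Xi_add_one_ne_zero {s : ℂ} (hs : 0 ≤ s.re) : Xi (s + 1) ≠ 0 :=
  Xi_ne_zero (by simpa using hs)

lemma differentiableAt_Q {s : ℂ} (hs : 0 ≤ s.re) : DifferentiableAt ℂ Q s := by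
  have := differentiable_Xi
  exact DifferentiableAt.div (by fun_prop) (by fun_prop) (Xi_add_one_ne_zero hs)

lemma norm_Q_le {s : ℂ} (hs : 0 ≤ s.re) : ‖Q s‖ ≤ 1 := by
  rw [Q, norm_div, div_le_one (norm_pos_iff.mpr (Xi_add_one_ne_zero hs))]
  exact norm_Xi_le_norm_Xi_add_one hs

lemma Q_zero : Q 0 = 1 := by simp [Q, Xi_zero, Xi_one]

lemma Q_one : Q 1 = ((3 / Real.pi : ℝ) : ℂ) := by
  rw [Q, Xi_one, one_add_one_eq_two, Xi_two]; push_cast; rw [one_div_div]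

lemma norm_Q_lt {s : ℂ} (hs : 0 < s.re) : ‖Q s‖ < 1 := by
  refine norm_lt_one_of_re_pos (fun z hz => (differentiableAt_Q (le_of_lt hz)).differentiableWithinAt)
    (fun z hz => norm_Q_le hz.le) (differentiableAt_Q (by simp)).continuousAt Q_zero
    (a := 1) (by simp) ?_ hs
  rw [Q_one]
  norm_cast
  have := Real.pi_gt_three
  rw [div_eq_one_iff_eq Real.pi_pos.ne']
  exact this.ne

lemma hasDerivAt_Q_zero : HasDerivAt Q (-2 * (J 1 : ℝ)) 0 := by
  have h1 : HasDerivAt Xi (J 1) (0 + 1) := by rw [zero_add]; exact hasDerivAt_Xi_one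
  have h2 := h1.comp (0 : ℂ) ((hasDerivAt_id (0 : ℂ)).add_const 1)
  have h := hasDerivAt_Xi_zero.div h2 (by simp [Xi_one])
  refine h.congr_deriv ?_
  simp [Xi_zero, Xi_one]
  ring

/-- The Cayley transform of `Q` with its polar part at the origin removed. -/
noncomputable def P1 (s : ℂ) : ℂ := (1 + Q s) / (1 - Q s) - 1 / ((J 1 : ℝ) * s)

lemma J_one_pos : 0 < J 1 :=
  (re_cayley_sub_nonneg (fun _ hz => (differentiableAt_Q (le_of_lt hz)).differentiableWithinAt)
    (fun _ hz => norm_Q_lt hz) hasDerivAt_Q_zero Q_zero).1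

lemma re_P1_nonneg {s : ℂ} (hs : 0 < s.re) : 0 ≤ (P1 s).re :=
  (re_cayley_sub_nonneg (fun _ hz => (differentiableAt_Q (le_of_lt hz)).differentiableWithinAt)
    (fun _ hz => norm_Q_lt hz) hasDerivAt_Q_zero Q_zero).2 s hs

lemma one_sub_Q_ne_zero {s : ℂ} (hs : 0 < s.re) : 1 - Q s ≠ 0 := fun h => by
  have := norm_Q_lt hs
  rw [← sub_eq_zero.mp h] at this
  simp at this

lemma differentiableOn_P1 : DifferentiableOn ℂ P1 {z | 0 < z.re} := by
  intro s hs
  have hs' : 0 < s.re := hs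
  have h0 : s ≠ 0 := by rintro rfl; simp at hs'
  have h1 := differentiableAt_Q hs'.le
  have h2 : ((J 1 : ℝ) : ℂ) * s ≠ 0 := mul_ne_zero (by exact_mod_cast J_one_pos.ne') h0
  exact (((h1.const_add 1).div (h1.const_sub 1) (one_sub_Q_ne_zero hs')).sub
    ((differentiableAt_const 1).div (by fun_prop) h2)).differentiableWithinAt

/-- The value of `P1` at `1`. -/
noncomputable def eps : ℝ := 1 + 2 / (Real.pi / 3 - 1) - 1 / J 1

lemma P1_one : P1 1 = eps := by
  have h1 := Real.pi_gt_three
  have h3 : (Real.pi : ℂ) ≠ 0 := by exact_mod_cast Real.pi_ne_zero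
  have h4 : (Real.pi : ℂ) - 3 ≠ 0 := by
    rw [sub_ne_zero]; exact_mod_cast h1.ne'
  have h5 : (J 1 : ℂ) ≠ 0 := by exact_mod_cast J_one_pos.ne'
  have h6 : (1 : ℂ) - 3 / Real.pi ≠ 0 := by
    rw [one_sub_div h3]; exact div_ne_zero h4 h3
  have h7 : (Real.pi : ℂ) / 3 - 1 ≠ 0 := by
    rw [div_sub_one three_ne_zero]; exact div_ne_zero h4 three_ne_zero
  rw [P1, Q_one, eps]
  push_cast
  rw [mul_one]
  congr 1
  field_simp
  ring

lemma eps_nonneg : 0 ≤ eps := by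
  have := re_P1_nonneg (s := 1) (by simp)
  rwa [P1_one, ofReal_re] at this

lemma J_one_eq : J 1 = (Real.eulerMascheroniConstant - Real.log (4 * Real.pi)) / 2 + 1 := by
  have h := completedRiemannZeta₀_one
  have h2 := completedRiemannZeta₀_ofReal 1
  push_cast at h2
  rw [h2] at h
  have h3 : (Complex.log (4 * Real.pi)) = (Real.log (4 * Real.pi) : ℝ) := by
    rw [ofReal_log (by positivity)]; push_cast; rfl
  rw [h3] at h
  exact_mod_cast h

lemma eps_le : eps ≤ 1 / 10 := by
  have hpi1 := Real.pi_gt_d20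
  have hpi2 := Real.pi_lt_d20
  have h1 := eulerMascheroniConstant_le_harmonic_sub_log 81
  have h2 : Real.log (4 * Real.pi) + Real.log ((81 : ℕ) + 1 / 2) =
      10 * Real.log 2 + Real.log (326 * Real.pi / 1024) := by
    rw [← Real.log_mul (by positivity) (by positivity),
      show 10 * Real.log 2 = Real.log (2 ^ 10) by rw [Real.log_pow]; norm_num,
      ← Real.log_mul (by positivity) (by positivity)]
    congr 1
    push_cast
    ring
  have h3 : 0.0001553 ≤ Real.log (326 * Real.pi / 1024) := by
    have := Real.one_sub_inv_le_log_of_pos (x := 326 * Real.pi / 1024) (by positivity)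
    refine le_trans ?_ this
    rw [inv_div, le_sub_comm, div_le_iff₀ (by positivity)]
    linarith
  have h4 := Real.log_two_gt_d9
  have h5 : (harmonic 81 : ℝ) ≤ 4.977825 := by
    rw [harmonic]
    simp only [Finset.sum_range_succ, Finset.sum_range_zero]
    norm_num
  have h6 : J 1 ≤ 0.0231078 := by
    rw [J_one_eq]; linarith
  have hJ := J_one_pos
  have h7 : 1 / 0.0231078 ≤ 1 / J 1 := one_div_le_one_div_of_le hJ h6
  have h8 : 2 / (Real.pi / 3 - 1) ≤ 42.37515 := by
    rw [div_le_iff₀ (by linarith)]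
    linarith
  rw [eps]
  norm_num at h7 h8 ⊢
  linarith

/-- The constant `π / 3 - 1`. -/
noncomputable def c0 : ℝ := Real.pi / 3 - 1

lemma c0_gt : 471975/10000000 < c0 := by
  have := Real.pi_gt_d20
  rw [c0]; norm_num at this ⊢; linarith

lemma c0_lt : c0 < 471976/10000000 := by
  have := Real.pi_lt_d20
  rw [c0]; norm_num at this ⊢; linarith

lemma c0_pos : 0 < c0 := by have := c0_gt; linarith

lemma two_div_c0_gt : 4237/100 < 2 / c0 := by
  rw [lt_div_iff₀ c0_pos]; have := c0_lt; linarith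

lemma two_div_c0_lt : 2 / c0 < 4238/100 := by
  rw [div_lt_iff₀ c0_pos]; have := c0_gt; linarith

lemma normSq_D_le {c x T : ℝ} (h1 : 471975/10000000 < c) (h2 : c < 471976/10000000)
    (hx1 : -(1/2) ≤ x) (hx2 : x ≤ 1/2) (hT : 0 ≤ T) :
    (1 + c * (x^2 - T))^2 + 4 * c^2 * x^2 * T ≤
      10237/10000 - 94395/1000000 * T + 2228/1000000 * (T + 1/4)^2 := by
  have hx : x^2 ≤ 1/4 := by nlinarith
  have hc : c^2 ≤ 2228/1000000 := by nlinarith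
  have h3 : (x^2+T)^2 ≤ (T+1/4)^2 :=
    pow_le_pow_left₀ (by positivity) (by linarith) 2
  have h4 : c^2*(x^2+T)^2 ≤ 2228/1000000 * (T+1/4)^2 := by gcongr
  have h5 : c * x^2 ≤ 471976/10000000 * (1/4) := by gcongr
  have h6 : 471975/10000000 * T ≤ c * T := by gcongr
  linarith

lemma exclusion {c e k2 x T : ℝ} (h1 : 471975/10000000 < c) (h2 : c < 471976/10000000)
    (he0 : 0 ≤ e) (he : e ≤ 1/10) (hk1 : 4237/100 < k2) (hk2 : k2 < 4238/100)
    (hx1 : -(1/2) ≤ x) (hx2 : x ≤ 1/2)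
    (hT : 0 ≤ T) (hT2 : T ≤ 45) (hT3 : T < 784/100 ∨ 1369/100 < T) :
    e^2 * ((1 + 4 * T) * (13/4 + T)^2 * ((1 + c * (x^2 - T))^2 + 4 * c^2 * x^2 * T)) <
      (c * (x^3 - 3 * x * T) + (4 + 2 * c - c * e) * (x^2 - T) + x + k2 - e)^2 := by
  have hD := normSq_D_le h1 h2 hx1 hx2 hT
  have hd0 : 0 ≤ (1 + c * (x^2 - T))^2 + 4 * c^2 * x^2 * T := by positivity
  have he2 : e^2 ≤ 1/100 := by nlinarith
  have hc0 : 0 < c := by linarith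
  have hx : x^2 ≤ 1/4 := by nlinarith
  have hx0 := sq_nonneg x
  have hxT : |x^3 - 3 * x * T| ≤ 1/8 + 3/2 * T := by
    have hxa : |x| ≤ 1/2 := abs_le.mpr ⟨by linarith, hx2⟩
    calc |x^3 - 3 * x * T| ≤ |x^3| + |3 * x * T| := abs_sub _ _
      _ = |x|^3 + 3 * |x| * T := by rw [abs_mul, abs_mul, abs_pow, abs_of_nonneg hT]; norm_num
      _ ≤ (1/2)^3 + 3 * (1/2) * T := by gcongr
      _ = _ := by ring
  have hxT2 : |c * (x^3 - 3 * x * T)| ≤ 471976/10000000 * (1/8 + 3/2 * T) := by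
    rw [abs_mul, abs_of_pos hc0]; gcongr
  have hce : c * e ≤ 471976/10000000 * (1/10) := by gcongr
  have hce0 : 0 ≤ c * e := by positivity
  obtain ⟨hl, hu⟩ := abs_le.mp hxT2
  obtain ⟨m, hm⟩ : ∃ m, m = 4 + 2 * c - c * e := ⟨_, rfl⟩
  have hm1 : 40896/10000 ≤ m := by linarith
  have hm2 : m ≤ 40944/10000 := by linarith
  have hmx : m * x^2 ≤ 40944/10000 * (1/4) := by gcongr
  have hmx0 : 0 ≤ m * x^2 := by positivity
  have hmT : m * T ≤ 40944/10000 * T := by gcongr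
  have hmT0 : 40896/10000 * T ≤ m * T := by gcongr
  rw [← hm]
  generalize (1 + c * (x^2 - T))^2 + 4 * c^2 * x^2 * T = d at hd0 hD ⊢
  obtain ⟨R, hR⟩ : ∃ R, R = c * (x^3 - 3 * x * T) + m * (x^2 - T) + x + k2 - e := ⟨_, rfl⟩
  rw [← hR]
  have hlow : 4165/100 - 41653/10000 * T ≤ R := by rw [hR, mul_sub m]; linarith
  have hup : R ≤ 4404/100 - 40187/10000 * T := by rw [hR, mul_sub m]; linarith
  have hL : e^2 * ((1 + 4 * T) * (13/4 + T)^2 * d) ≤ 1/100 * ((1 + 4 * T) * (13/4 + T)^2 * d) := by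
    gcongr
  refine hL.trans_lt ?_
  clear hL hR hl hu hxT2 hxT hm hmx hmx0 hmT hmT0 hm1 hm2 hce hce0
  rcases hT3 with hT3 | hT3
  · have hd1 : d ≤ 103/100 := by nlinarith
    calc 1/100 * ((1 + 4 * T) * (13/4 + T)^2 * d)
        ≤ 1/100 * ((1 + 4 * (784/100)) * (13/4 + 784/100)^2 * (103/100)) := by gcongr
      _ < (8:ℝ)^2 := by norm_num
      _ ≤ R^2 := pow_le_pow_left₀ (by norm_num) (by linarith) 2
  · rcases le_total T 20 with h20 | h20
    · have hd1 : d ≤ 20/100 := by nlinarith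
      calc 1/100 * ((1 + 4 * T) * (13/4 + T)^2 * d)
          ≤ 1/100 * ((1 + 4 * 20) * (13/4 + 20)^2 * (20/100)) := by gcongr
        _ < (10:ℝ)^2 := by norm_num
        _ ≤ (-R)^2 := pow_le_pow_left₀ (by norm_num) (by linarith) 2
        _ = R^2 := by ring
    · have hd1 : d ≤ 14/10 := by nlinarith
      calc 1/100 * ((1 + 4 * T) * (13/4 + T)^2 * d)
          ≤ 1/100 * ((1 + 4 * T) * (13/4 + T)^2 * (14/10)) := by gcongr
        _ < (40187/10000 * T - 4404/100)^2 := by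
            nlinarith [mul_nonneg (sub_nonneg.2 h20) (sub_nonneg.2 hT2),
              mul_nonneg (mul_nonneg (sub_nonneg.2 h20) (sub_nonneg.2 hT2)) hT]
        _ ≤ (-R)^2 := pow_le_pow_left₀ (by linarith) (by linarith) 2
        _ = R^2 := by ring

open ComplexConjugate

/-- The factor of `wengSp4P1` multiplying `Xi (2 * s)`. -/
noncomputable def G (s : ℂ) : ℂ :=
  (s - 1) * (c0 * s + (1 - c0)) * Xi (s + 1) - (s - 2) * Xi s

/-- The quadratic polynomial `c0 * (s - 1) ^ 2 + 1`. -/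
noncomputable def D (s : ℂ) : ℂ := c0 * (s - 1)^2 + 1

/-- `G` normalised so as to be affine in `P1`. -/
noncomputable def Phi (s : ℂ) : ℂ := D s * (P1 s + (1 / J 1 : ℝ) / s + 1) + 2 * (s - 2)

lemma differentiable_G : Differentiable ℂ G := by
  have := differentiable_Xi
  unfold G
  fun_prop

lemma G_conj (s : ℂ) : G (conj s) = conj (G s) := by
  have h : conj s + 1 = conj (s + 1) := by simp
  have h2 : (conj (2 : ℂ)) = 2 := Complex.conj_ofNat 2
  rw [G, G, h, Xi_conj, Xi_conj]
  simp [h2]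

lemma Phi_mul {s : ℂ} (hs : 0 < s.re) : Phi s * ((1 - Q s) * Xi (s + 1)) = 2 * G s := by
  have h0 : s ≠ 0 := by rintro rfl; simp at hs
  have h1 := one_sub_Q_ne_zero hs
  have h2 := Xi_add_one_ne_zero hs.le
  have h3 : ((J 1 : ℝ) : ℂ) ≠ 0 := by exact_mod_cast J_one_pos.ne'
  have h4 : P1 s + (1 / J 1 : ℝ) / s + 1 = 2 / (1 - Q s) := by
    rw [P1]; push_cast; field_simp; ring
  have h5 : Xi s = Q s * Xi (s + 1) := by rw [Q, div_mul_cancel₀ _ h2]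
  rw [Phi, h4, G, h5, D]
  field_simp
  ring

lemma Phi_eq_zero_iff {s : ℂ} (hs : 0 < s.re) : Phi s = 0 ↔ G s = 0 := by
  have h := Phi_mul hs
  have h1 := mul_ne_zero (one_sub_Q_ne_zero hs) (Xi_add_one_ne_zero hs.le)
  constructor
  · intro h0
    rw [h0, zero_mul] at h
    simpa using h.symm
  · intro h0
    rw [h0, mul_zero] at h
    exact (mul_eq_zero.mp h).resolve_right h1

lemma one_div_J_one : 1 / J 1 = 1 + 2 / c0 - eps := by
  rw [eps, c0]; ring

lemma norm_P1_le {s : ℂ} (hs : 0 < s.re) : ‖P1 s‖ * s.re ≤ eps * (‖s‖^2 + 1) := by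
  have h := re_mul_re_le_of_schwarz_pick differentiableOn_P1 (fun z hz => re_P1_nonneg hz) hs
    (show 0 < (1 : ℂ).re by simp)
  rw [P1_one] at h
  have e1 : ‖P1 s + conj ((eps : ℝ) : ℂ)‖^2 = ‖P1 s‖^2 + 2 * eps * (P1 s).re + eps^2 := by
    rw [Complex.sq_norm, Complex.sq_norm, normSq_apply, normSq_apply]
    simp; ring
  have e2 : ‖s + conj (1 : ℂ)‖^2 = ‖s‖^2 + 2 * s.re + 1 := by
    rw [Complex.sq_norm, Complex.sq_norm, normSq_apply, normSq_apply]
    simp; ring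
  rw [e1, e2] at h
  simp only [one_re, ofReal_re, mul_one] at h
  have h2 := (Complex.re_le_norm (P1 s))
  have h3 := eps_nonneg
  have h4 := norm_nonneg (P1 s)
  rcases h4.eq_or_lt with h4 | h4
  · rw [← h4]; nlinarith [sq_nonneg ‖s‖]
  · refine le_of_mul_le_mul_left ?_ h4
    have h5 : eps * (P1 s).re * (‖s‖^2 + 1) ≤ eps * ‖P1 s‖ * (‖s‖^2 + 1) := by gcongr
    nlinarith [mul_nonneg hs.le (sq_nonneg eps)]

lemma normSq_D (s : ℂ) : ‖D s‖^2 =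
    (1 + c0 * ((s.re - 1)^2 - s.im^2))^2 + 4 * c0^2 * (s.re - 1)^2 * s.im^2 := by
  rw [Complex.sq_norm, normSq_apply]
  simp [D, pow_two]
  ring

lemma bounds_of_G_eq_zero {s : ℂ} (hs : 1/2 ≤ s.re) (h : G s = 0) :
    s.re < 3/2 ∧ s.im^2 ≤ 45 := by
  have hs0 : 0 < s.re := by linarith
  have h2 := Xi_add_one_ne_zero hs0.le
  have h5 : Xi s = Q s * Xi (s + 1) := by rw [Q, div_mul_cancel₀ _ h2]
  have h6 : (s - 1) * (c0 * s + (1 - c0)) = (s - 2) * Q s := by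
    rw [G, h5] at h
    apply mul_right_cancel₀ h2
    linear_combination h
  have h7 : ‖(s - 1) * (c0 * s + (1 - c0))‖^2 ≤ ‖s - 2‖^2 := by
    rw [h6, norm_mul]
    gcongr
    exact mul_le_of_le_one_right (norm_nonneg _) (norm_Q_le hs0.le)
  rw [norm_mul, mul_pow] at h7
  simp only [Complex.sq_norm, normSq_apply] at h7
  simp at h7
  obtain ⟨x, hx⟩ : ∃ x, x = s.re - 1 := ⟨_, rfl⟩
  have hx' : s.re = x + 1 := by linarith
  rw [hx'] at h7 hs ⊢
  generalize s.im = t at h7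
  have c1 := c0_gt
  have c2 := c0_lt
  have h8 : (x^2 + t^2) * ((1 + c0 * x)^2 + c0^2 * t^2) ≤ (x - 1)^2 + t^2 := by
    linarith
  have hxl : x < 1/2 := by
    by_contra! hc
    have ha : (1:ℝ) < (1 + c0 * x)^2 := by nlinarith [mul_pos c0_pos (by linarith : 0 < x)]
    have hb : (x^2 + t^2) * 1 < (x^2 + t^2) * ((1 + c0 * x)^2 + c0^2 * t^2) := by
      apply mul_lt_mul_of_pos_left
      · nlinarith [mul_nonneg (sq_nonneg c0) (sq_nonneg t)]
      · nlinarith [sq_nonneg t]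
    nlinarith
  refine ⟨by linarith, ?_⟩
  by_contra! hc
  have hx2 : -(1/2) ≤ x := by linarith
  have ha : (953/1000:ℝ) ≤ (1 + c0 * x)^2 := by
    have : 9764/10000 ≤ 1 + c0 * x := by nlinarith
    nlinarith
  have hb : (22275/10000000 : ℝ) ≤ c0^2 := by nlinarith
  have hcT : (22275/10000000 : ℝ) * t^2 ≤ c0^2 * t^2 := by gcongr
  have hd : (t^2) * (953/1000 + 22275/10000000 * t^2) ≤
      (x^2 + t^2) * ((1 + c0 * x)^2 + c0^2 * t^2) := by
    gcongr
    · nlinarith [sq_nonneg x]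
  nlinarith

lemma im_sq_of_G_eq_zero {s : ℂ} (hs : 1/2 ≤ s.re) (h : G s = 0) :
    784/100 ≤ s.im^2 ∧ s.im^2 ≤ 1369/100 := by
  obtain ⟨hre, him⟩ := bounds_of_G_eq_zero hs h
  by_contra hcon
  have hT3 : s.im^2 < 784/100 ∨ 1369/100 < s.im^2 := by
    by_contra! hh; exact hcon hh
  have hs0 : 0 < s.re := by linarith
  have h0 : s ≠ 0 := by rintro rfl; simp at hs0
  have hex := exclusion c0_gt c0_lt eps_nonneg eps_le two_div_c0_gt two_div_c0_lt
    (x := s.re - 1) (by linarith) (by linarith) (sq_nonneg s.im) him hT3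
  have hPhi := (Phi_eq_zero_iff hs0).mpr h
  have hk := one_div_J_one
  have hC : s * D s * P1 s = -(c0 * (s - 1)^3 + (4 + 2 * c0 - c0 * eps) * (s - 1)^2 + (s - 1)
      + (2 / c0 : ℝ) - eps) := by
    have hc : (c0 : ℂ) ≠ 0 := by exact_mod_cast c0_pos.ne'
    rw [Phi, hk] at hPhi
    have e : s * (D s * (P1 s + ((1 + 2 / c0 - eps : ℝ) : ℂ) / s + 1) + 2 * (s - 2)) =
        s * D s * P1 s + (D s * (((1 + 2 / c0 - eps : ℝ) : ℂ) + s) + 2 * s * (s - 2)) := by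
      field_simp
      ring
    rw [hPhi, mul_zero] at e
    rw [eq_neg_of_add_eq_zero_left e.symm, D]
    push_cast
    field_simp
    ring
  have hre2 : (c0 * (s - 1)^3 + (4 + 2 * c0 - c0 * eps) * (s - 1)^2 + (s - 1)
      + (2 / c0 : ℝ) - eps : ℂ).re = c0 * ((s.re - 1)^3 - 3 * (s.re - 1) * s.im^2)
      + (4 + 2 * c0 - c0 * eps) * ((s.re - 1)^2 - s.im^2) + (s.re - 1) + 2 / c0 - eps := by
    have e : (c0 * (s - 1)^3 + (4 + 2 * c0 - c0 * eps) * (s - 1)^2 + (s - 1)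
      + (2 / c0 : ℝ) - eps : ℂ) = (c0 : ℝ) * (s - 1)^3 +
        ((4 + 2 * c0 - c0 * eps : ℝ) : ℂ) * (s - 1)^2 + (s - 1)
      + (2 / c0 : ℝ) - eps := by push_cast; ring
    rw [e]
    simp only [sub_re, add_re, ofReal_re, one_re, pow_succ, pow_zero, mul_re,
      mul_im, sub_im, one_im, one_mul, ofReal_im]
    ring
  have h1 := Complex.abs_re_le_norm (c0 * (s - 1)^3 + (4 + 2 * c0 - c0 * eps) * (s - 1)^2 + (s - 1)
      + (2 / c0 : ℝ) - eps : ℂ)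
  rw [hre2, ← norm_neg, ← hC, norm_mul, norm_mul] at h1
  have h2 := sq_le_sq' (by linarith [abs_nonneg (c0 * ((s.re - 1)^3 - 3 * (s.re - 1) * s.im^2)
      + (4 + 2 * c0 - c0 * eps) * ((s.re - 1)^2 - s.im^2) + (s.re - 1) + 2 / c0 - eps)]) h1
  rw [sq_abs] at h2
  refine absurd (hex.trans_le h2) (not_lt.mpr ?_)
  rw [← normSq_D, mul_pow, mul_pow]
  have h3 := norm_P1_le hs0
  have e3 : ‖s‖^2 = s.re^2 + s.im^2 := by rw [Complex.sq_norm, normSq_apply]; ring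
  have h4 : (‖P1 s‖ * s.re)^2 ≤ (eps * (13/4 + s.im^2))^2 := by
    refine pow_le_pow_left₀ (by positivity) (h3.trans ?_) 2
    refine mul_le_mul_of_nonneg_left ?_ eps_nonneg
    rw [e3]
    clear * - hs hre
    nlinarith
  have h5 : ‖s‖^2 ≤ (1 + 4 * s.im^2) * s.re^2 := by
    have h6 : 0 ≤ 4 * s.re^2 - 1 := by clear * - hs; nlinarith
    rw [e3]
    linarith [mul_nonneg (sq_nonneg s.im) h6]
  have hsr : 0 < s.re^2 := by positivity
  calc ‖s‖^2 * ‖D s‖^2 * ‖P1 s‖^2 ≤ ((1 + 4 * s.im^2) * s.re^2) * ‖D s‖^2 * ‖P1 s‖^2 := by gcongr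
    _ = (1 + 4 * s.im^2) * ‖D s‖^2 * (‖P1 s‖ * s.re)^2 := by ring
    _ ≤ (1 + 4 * s.im^2) * ‖D s‖^2 * (eps * (13/4 + s.im^2))^2 := by gcongr
    _ = _ := by ring

/-- The box containing all zeros of `G` in the part of the upper half-plane with `1/2 ≤ Re s`. -/
def box : Set ℂ := {s | 1/2 ≤ s.re ∧ s.re ≤ 3/2 ∧ 14/5 ≤ s.im ∧ s.im ≤ 37/10}

lemma box_re_pos {s : ℂ} (hs : s ∈ box) : 0 < s.re := by have := hs.1; linarith

lemma box_im_sq {s : ℂ} (hs : s ∈ box) : 784/100 ≤ s.im^2 ∧ s.im^2 ≤ 1369/100 := by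
  obtain ⟨_, _, h3, h4⟩ := hs
  constructor <;> nlinarith

lemma normSq_D_le_of_box {s : ℂ} (hs : s ∈ box) :
    ‖D s‖^2 ≤ 10237/10000 - 94395/1000000 * s.im^2 + 2228/1000000 * (s.im^2 + 1/4)^2 := by
  rw [normSq_D]
  exact normSq_D_le c0_gt c0_lt (by linarith [hs.1]) (by linarith [hs.2.1]) (sq_nonneg _)

lemma norm_D_le {s : ℂ} (hs : s ∈ box) : ‖D s‖ ≤ 66/100 := by
  refine (sq_le_sq₀ (norm_nonneg _) (by norm_num)).mp ((normSq_D_le_of_box hs).trans ?_)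
  obtain ⟨h1, h2⟩ := box_im_sq hs
  nlinarith

lemma norm_P1_mul_D_le {s : ℂ} (hs : s ∈ box) : ‖P1 s‖ * ‖D s‖ ≤ 128/100 := by
  have hs0 := box_re_pos hs
  obtain ⟨h1, h2⟩ := box_im_sq hs
  have h3 := norm_P1_le hs0
  have h4 : ‖s‖^2 + 1 ≤ 2 * s.re * (5/4 + s.im^2) := by
    have : ‖s‖^2 = s.re^2 + s.im^2 := by rw [Complex.sq_norm, normSq_apply]; ring
    have h5 := hs.1
    have h6 := hs.2.1
    rw [this]
    nlinarith [mul_nonneg (sq_nonneg s.im) (by linarith : 0 ≤ 2 * s.re - 1)]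
  have h5 : ‖P1 s‖ ≤ 1/5 * (5/4 + s.im^2) := by
    refine le_of_mul_le_mul_right ?_ hs0
    calc ‖P1 s‖ * s.re ≤ eps * (‖s‖^2 + 1) := h3
      _ ≤ 1/10 * (2 * s.re * (5/4 + s.im^2)) := by
          gcongr
          exact eps_le
      _ = _ := by ring
  refine (sq_le_sq₀ (by positivity) (by norm_num)).mp ?_
  have h6 := normSq_D_le_of_box hs
  rw [mul_pow]
  refine (mul_le_mul (pow_le_pow_left₀ (norm_nonneg _) h5 2) h6 (by positivity)
    (by positivity)).trans ?_
  obtain ⟨y, hy⟩ : ∃ y, y = s.im^2 + 1/4 := ⟨_, rfl⟩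
  rw [show s.im^2 = y - 1/4 by linarith] at h1 h2 ⊢
  nlinarith [mul_nonneg (sq_nonneg (y - 1115/100))
    (mul_nonneg (by linarith : 0 ≤ y - 809/100) (by linarith : 0 ≤ 1394/100 - y)),
    sq_nonneg (y - 1115/100), mul_nonneg (sq_nonneg (y - 1115/100)) (by linarith : 0 ≤ 1394/100 - y)]

lemma re_div_mul_div_le {s z : ℂ} (hs : s ∈ box) (hz : z ∈ box) :
    (D s / s * (D z / z)).re ≤ 18225/1000000 := by
  have key : ∀ s ∈ box, |(D s / s).re| ≤ 135/1000 ∧ (D s / s).im ≤ 0 := by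
    intro s hs
    obtain ⟨h1, h2⟩ := box_im_sq hs
    obtain ⟨h3, h4, h5, h6⟩ := hs
    have hn : 0 < normSq s := normSq_pos.mpr (by rintro rfl; norm_num at h3)
    have e1 : (D s).re = 1 + c0 * ((s.re - 1)^2 - s.im^2) := by
      simp [D, pow_two]; ring
    have e2 : (D s).im = 2 * c0 * (s.re - 1) * s.im := by
      simp [D, pow_two]; ring
    have c1 := c0_gt
    have c2 := c0_lt
    obtain ⟨x, hx⟩ : ∃ x, x = s.re - 1 := ⟨_, rfl⟩
    have hx' : s.re = x + 1 := by linarith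
    have hx1 : -(1/2) ≤ x := by linarith
    have hx2 : x ≤ 1/2 := by linarith
    have hxx : x^2 ≤ 1/4 := by nlinarith
    rw [div_re, div_im, ← add_div, ← sub_div, abs_div, abs_of_pos hn, div_le_iff₀ hn,
      div_le_iff₀ hn, e1, e2, normSq_apply, hx', zero_mul]
    have f : c0 * s.im^2 ≤ 471976/10000000 * (1369/100) := by gcongr
    have f0 : 471975/10000000 * s.im^2 ≤ c0 * s.im^2 := by gcongr
    have f2 : c0 * x^2 ≤ 471976/10000000 * (1/4) := by gcongr
    have f3 : c0 * x ≤ 471976/10000000 * (1/2) := by nlinarith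
    have f4 : 0 ≤ c0 * x^2 := by have := c0_pos; positivity
    constructor
    · have hE : (1 + c0 * ((x + 1 - 1)^2 - s.im^2)) * (x + 1) + 2 * c0 * (x + 1 - 1) * s.im * s.im =
          1 + x + c0 * x^2 * (1 + x) - c0 * s.im^2 * (1 - x) := by ring
      rw [hE, abs_le]
      constructor
      · nlinarith
      · nlinarith
    · have hE : 2 * c0 * (x + 1 - 1) * s.im * (x + 1) - (1 + c0 * ((x + 1 - 1)^2 - s.im^2)) * s.im =
        -(s.im * (1 - 2 * (c0 * x) - c0 * x^2 - c0 * s.im^2)) := by ring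
      rw [hE, neg_nonpos]
      exact mul_nonneg (by linarith) (by linarith)
  obtain ⟨a1, b1⟩ := key s hs
  obtain ⟨a2, b2⟩ := key z hz
  rw [mul_re]
  have h1 : (D s / s).re * (D z / z).re ≤ 135/1000 * (135/1000) :=
    (le_abs_self _).trans (by rw [abs_mul]; gcongr)
  nlinarith [mul_nonneg_of_nonpos_of_nonpos b1 b2]

/-- A zero of `G` in the box is simple and is the only one, quantitatively. -/
lemma norm_sub_le_norm_Phi {s z : ℂ} (hs : s ∈ box) (hz : z ∈ box) (h : G s = 0) :
    1/10 * ‖s - z‖ ≤ ‖Phi z‖ := by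
  have hs0 := box_re_pos hs
  have hz0 := box_re_pos hz
  have hPhi := (Phi_eq_zero_iff hs0).mpr h
  have s0 : s ≠ 0 := by rintro rfl; simp at hs0
  have z0 : z ≠ 0 := by rintro rfl; simp at hz0
  obtain ⟨k, hk⟩ : ∃ k : ℝ, k = 1 / J 1 := ⟨_, rfl⟩
  obtain ⟨A, hA⟩ : ∃ A : ℂ, A = ((2 : ℝ) : ℂ) * (1 + c0 * (s - 1 + (z - 1)) - c0 * ((s - 1) * (z - 1)))
    - (k : ℂ) * (D s / s * (D z / z)) := ⟨_, rfl⟩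
  have hid : (s - z) * A = D s * D z * (P1 z - P1 s) - D s * Phi z := by
    rw [Phi, ← hk] at hPhi ⊢
    have h2 : D s * P1 s = -(D s * (k / s + 1) + 2 * (s - 2)) := by linear_combination hPhi
    have h3 : D s * D z * (P1 z - P1 s) = D s * D z * P1 z - D z * (D s * P1 s) := by ring
    rw [h3, h2, hA]
    simp only [D]
    push_cast
    field_simp
    ring
  have hAre : 183/100 ≤ A.re := by
    rw [hA, sub_re, re_ofReal_mul, re_ofReal_mul]
    have h1 := re_div_mul_div_le hs hz
    have hk1 : 0 < k := by rw [hk]; exact one_div_pos.mpr J_one_pos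
    have hk2 : k ≤ 4338/100 := by
      rw [hk, one_div_J_one]; linarith [two_div_c0_lt, eps_nonneg]
    have h2 : k * (D s / s * (D z / z)).re ≤ 4338/100 * (18225/1000000) := by
      calc _ ≤ k * (18225/1000000) := by gcongr
        _ ≤ _ := by gcongr
    have hnum : (1 + c0 * (s - 1 + (z - 1)) - c0 * ((s - 1) * (z - 1)) : ℂ).re =
        1 + c0 * (s.re - 1 + (z.re - 1) - ((s.re - 1) * (z.re - 1) - s.im * z.im)) := by
      simp
      ring
    rw [hnum]
    have hc := c0_gt
    have hc' := c0_lt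
    obtain ⟨a1, a2, a3, a4⟩ := hs
    obtain ⟨b1, b2, b3, b4⟩ := hz
    have h3 : 784/100 ≤ s.im * z.im := by nlinarith
    have h4 : (s.re - 1) * (z.re - 1) ≤ 1/4 := by nlinarith
    have h5 : c0 * (-1 - 1/4 + 784/100) ≤ c0 * (s.re - 1 + (z.re - 1)
        - ((s.re - 1) * (z.re - 1) - s.im * z.im)) := by
      have := c0_pos
      gcongr
      linarith
    nlinarith
  have hsp : ‖P1 z - P1 s‖ ≤ ‖s - z‖ * (‖P1 s‖ + ‖P1 z‖) := by
    have h1 := schwarz_pick differentiableOn_P1 (fun z hz => re_P1_nonneg hz) hs0 hz0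
    have h2 : 1 ≤ ‖s + conj z‖ := by
      refine le_trans ?_ (Complex.re_le_norm _)
      simp only [add_re, conj_re]
      linarith [hs.1, hz.1]
    calc ‖P1 z - P1 s‖ = ‖P1 s - P1 z‖ * 1 := by rw [mul_one, norm_sub_rev]
      _ ≤ ‖P1 s - P1 z‖ * ‖s + conj z‖ := by gcongr
      _ ≤ _ := h1
      _ ≤ _ := by
        gcongr
        refine (norm_add_le _ _).trans ?_
        rw [RCLike.norm_conj]
  have hD1 := norm_D_le hs
  have hD2 := norm_D_le hz
  have hP1 := norm_P1_mul_D_le hs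
  have hP2 := norm_P1_mul_D_le hz
  have hbig : ‖D s‖ * ‖D z‖ * (‖P1 s‖ + ‖P1 z‖) ≤ 169/100 := by
    have h1 : (‖P1 s‖ * ‖D s‖) * ‖D z‖ ≤ 128/100 * (66/100) := by gcongr
    have h2 : (‖P1 z‖ * ‖D z‖) * ‖D s‖ ≤ 128/100 * (66/100) := by gcongr
    linarith
  have hfin : ‖s - z‖ * (183/100) ≤ ‖s - z‖ * (169/100) + 66/100 * ‖Phi z‖ := by
    calc ‖s - z‖ * (183/100) ≤ ‖s - z‖ * ‖A‖ := by
          gcongr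
          exact hAre.trans (Complex.re_le_norm _)
      _ = ‖D s * D z * (P1 z - P1 s) - D s * Phi z‖ := by rw [← hid, norm_mul]
      _ ≤ ‖D s‖ * ‖D z‖ * ‖P1 z - P1 s‖ + ‖D s‖ * ‖Phi z‖ := by
          refine (norm_sub_le _ _).trans ?_
          rw [norm_mul, norm_mul, norm_mul]
      _ ≤ ‖D s‖ * ‖D z‖ * (‖s - z‖ * (‖P1 s‖ + ‖P1 z‖)) + 66/100 * ‖Phi z‖ := by gcongr
      _ = ‖s - z‖ * (‖D s‖ * ‖D z‖ * (‖P1 s‖ + ‖P1 z‖)) + 66/100 * ‖Phi z‖ := by ring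
      _ ≤ _ := by gcongr
  linarith [norm_nonneg (Phi z), norm_nonneg (s - z)]

lemma mem_box_of_G_eq_zero {s : ℂ} (hs : 1/2 ≤ s.re) (hi : 0 ≤ s.im) (h : G s = 0) :
    s ∈ box ∧ s.re < 3/2 := by
  have h1 := (bounds_of_G_eq_zero hs h).1
  obtain ⟨h2, h3⟩ := im_sq_of_G_eq_zero hs h
  exact ⟨⟨hs, h1.le, by nlinarith, by nlinarith⟩, h1⟩

lemma differentiable_dslope {f : ℂ → ℂ} (hf : Differentiable ℂ f) (c : ℂ) :
    Differentiable ℂ (dslope f c) := by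
  rw [← differentiableOn_univ] at hf ⊢
  exact (Complex.differentiableOn_dslope Filter.univ_mem).mpr hf

lemma ne_zero_of_G_eq_mul {p : ℂ} {g : ℂ → ℂ} (hp : p ∈ box) (hp' : p.re < 3/2)
    (hg : Differentiable ℂ g) (h : ∀ s, G s = (s - p) * (s - conj p) * g s) : g p ≠ 0 := by
  intro h0
  have hp0 := box_re_pos hp
  have hGp : G p = 0 := by rw [h p]; ring
  obtain ⟨F, hF⟩ : ∃ F : ℂ → ℂ, F = fun z => 2 * (z - conj p) * g z / ((1 - Q z) * Xi (z + 1)) :=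
    ⟨_, rfl⟩
  have hFc : ContinuousAt F p := by
    have h1 := (differentiableAt_Q hp0.le).continuousAt
    have h2 := differentiable_Xi.continuous
    have h3 := hg.continuous
    rw [hF]
    exact ContinuousAt.div (by fun_prop) (by fun_prop)
      (mul_ne_zero (one_sub_Q_ne_zero hp0) (Xi_add_one_ne_zero hp0.le))
  have hFp : F p = 0 := by rw [hF]; simp [h0]
  have hx : Filter.Tendsto (fun x : ℝ => p + (x : ℂ)) (nhdsWithin 0 (Set.Ioi 0)) (nhds p) :=
    ((by fun_prop : Continuous fun x : ℝ => p + (x : ℂ)).tendsto' 0 p (by simp)).mono_left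
      nhdsWithin_le_nhds
  have hlim := (hFc.tendsto.comp hx).norm
  rw [hFp, norm_zero] at hlim
  have hge : ∀ᶠ x : ℝ in nhdsWithin 0 (Set.Ioi 0), 1/10 ≤ ‖F (p + x)‖ := by
    filter_upwards [Ioo_mem_nhdsGT (sub_pos.mpr hp')] with x hx
    have hx0 : 0 < x := hx.1
    have hxb : p + x ∈ box := by
      obtain ⟨a1, a2, a3, a4⟩ := hp
      have := hx.2
      exact ⟨by simp; linarith, by simp; linarith, by simpa using a3, by simpa using a4⟩
    have h1 := norm_sub_le_norm_Phi hp hxb hGp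
    have h2 := box_re_pos hxb
    have h3 := Phi_mul h2
    have h4 := mul_ne_zero (one_sub_Q_ne_zero h2) (Xi_add_one_ne_zero h2.le)
    have h5 : Phi (p + x) = x * F (p + x) := by
      rw [hF]
      simp only
      rw [← mul_div_assoc, eq_div_iff h4, h3, h]
      ring
    rw [h5, norm_mul, show p - (p + x) = -(x : ℂ) by ring, norm_neg, norm_real,
      Real.norm_of_nonneg hx0.le, mul_comm] at h1
    exact le_of_mul_le_mul_left h1 hx0
  have := ge_of_tendsto hlim hge
  norm_num at this

lemma exists_G_eq_mul : ∃ g : ℂ → ℂ, Differentiable ℂ g ∧ (∀ s : ℂ, 1/2 ≤ s.re → g s ≠ 0) ∧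
    (∀ s, g (conj s) = conj (g s)) ∧ ((∀ s, G s = g s) ∨
      ∃ p : ℂ, 1/2 ≤ p.re ∧ ∀ s, G s = (s - p) * (s - conj p) * g s) := by
  by_cases h : ∀ s : ℂ, 1/2 ≤ s.re → G s ≠ 0
  · exact ⟨G, differentiable_G, h, G_conj, Or.inl fun _ => rfl⟩
  push Not at h
  obtain ⟨p, hp, hpi, hGp⟩ : ∃ p : ℂ, 1/2 ≤ p.re ∧ 0 ≤ p.im ∧ G p = 0 := by
    obtain ⟨p, hp, hGp⟩ := h
    rcases le_total 0 p.im with hi | hi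
    · exact ⟨p, hp, hi, hGp⟩
    · exact ⟨conj p, by simpa using hp, by simpa using hi, by rw [G_conj, hGp, map_zero]⟩
  obtain ⟨hpb, hp'⟩ := mem_box_of_G_eq_zero hp hpi hGp
  have hne : conj p ≠ p := by
    intro he
    have h1 := hpb.2.2.1
    have h2 := congrArg Complex.im he
    rw [conj_im] at h2
    linarith
  obtain ⟨g1, hg1⟩ : ∃ g1, g1 = dslope G p := ⟨_, rfl⟩
  have hg1d : Differentiable ℂ g1 := hg1 ▸ differentiable_dslope differentiable_G p
  have hG1 : ∀ s, G s = (s - p) * g1 s := fun s => by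
    have := sub_smul_dslope G p s
    rw [hGp, sub_zero, smul_eq_mul] at this
    rw [← this, hg1]
  have hg1p : g1 (conj p) = 0 := by
    have h1 := hG1 (conj p)
    rw [G_conj, hGp, map_zero] at h1
    exact (mul_eq_zero.mp h1.symm).resolve_left (sub_ne_zero.mpr hne)
  obtain ⟨g, hg⟩ : ∃ g, g = dslope g1 (conj p) := ⟨_, rfl⟩
  have hgd : Differentiable ℂ g := hg ▸ differentiable_dslope hg1d _
  have hG : ∀ s, G s = (s - p) * (s - conj p) * g s := fun s => by
    have := sub_smul_dslope g1 (conj p) s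
    rw [hg1p, sub_zero, smul_eq_mul] at this
    rw [hG1, ← this, hg, mul_assoc]
  have hconj : ∀ s, g (conj s) = conj (g s) := by
    have hc := hgd.continuous
    have hcc := Complex.continuous_conj
    have hdense : Dense ({p, conj p} : Set ℂ)ᶜ :=
      (Set.toFinite _).countable.dense_compl ℝ
    have heq : (fun s => g (conj s)) = fun s => conj (g s) := by
      refine Continuous.ext_on hdense (hc.comp hcc) (hcc.comp hc) fun s hs => ?_
      simp only [Set.mem_compl_iff, Set.mem_insert_iff, Set.mem_singleton_iff, not_or] at hs
      have h1 := hG (conj s)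
      rw [G_conj, hG s, map_mul, map_mul, map_sub, map_sub, conj_conj] at h1
      have h2 : (conj s - conj p) * (conj s - p) ≠ 0 := by
        refine mul_ne_zero (sub_ne_zero.mpr ?_) (sub_ne_zero.mpr ?_)
        · exact fun h => hs.1 ((starRingEnd ℂ).injective h)
        · intro h; exact hs.2 (by rw [← h, conj_conj])
      exact (mul_left_cancel₀ h2 (h1.trans (by ring))).symm
    exact fun s => congrFun heq s
  have key : ∀ s : ℂ, 1/2 ≤ s.re → 0 ≤ s.im → g s ≠ 0 := by
    intro s hs hsi h0
    have hGs : G s = 0 := by rw [hG, h0, mul_zero]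
    have hsb := (mem_box_of_G_eq_zero hs hsi hGs).1
    have h1 := norm_sub_le_norm_Phi hpb hsb hGp
    rw [(Phi_eq_zero_iff (box_re_pos hsb)).mpr hGs, norm_zero] at h1
    have h2 : ‖p - s‖ = 0 := le_antisymm (by linarith) (norm_nonneg _)
    have h3 : p = s := sub_eq_zero.mp (norm_eq_zero.mp h2)
    exact ne_zero_of_G_eq_mul hpb hp' hgd hG (h3 ▸ h0)
  refine ⟨g, hgd, fun s hs => ?_, hconj, Or.inr ⟨p, hp, hG⟩⟩
  rcases le_total 0 s.im with hi | hi
  · exact key s hs hi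
  · intro h0
    exact key (conj s) (by simpa using hs) (by simpa using hi) (by rw [hconj, h0, map_zero])

/-- The quotient whose comparison with a ratio of polynomials governs the zeros. -/
noncomputable def V (g : ℂ → ℂ) (s : ℂ) : ℂ :=
  Xi (2 * s - 1) * g (1 - s) / (Xi (2 * s) * g s)

lemma norm_G_one_sub_le {s : ℂ} (hs : 1/2 ≤ s.re) (hR : 1000 ≤ ‖s‖) :
    ‖G (1 - s)‖ ≤ 4 * ‖G s‖ := by
  obtain ⟨r, hr⟩ : ∃ r, r = ‖s‖ := ⟨_, rfl⟩
  rw [← hr] at hR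
  have c1 := c0_gt
  have c2 := c0_lt
  have hc : ‖(c0 : ℂ)‖ = c0 := by rw [norm_real, Real.norm_of_nonneg c0_pos.le]
  have x1 := norm_Xi_le_norm_Xi_add_one (s := s) (by linarith)
  have x2 := norm_Xi_sub_one_le hs
  have hX := norm_nonneg (Xi (s + 1))
  have hup : ‖G (1 - s)‖ ≤ (r * (1 + c0 * r) + (r + 1)) * ‖Xi (s + 1)‖ := by
    have e : G (1 - s) = -(s * (1 - c0 * s)) * Xi (s - 1) + (s + 1) * Xi s := by
      have e1 : Xi (1 - s + 1) = Xi (s - 1) := by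
        rw [← Xi_one_sub (s - 1)]; congr 1; ring
      rw [G, e1, Xi_one_sub]
      ring
    have h1 : ‖1 - c0 * s‖ ≤ 1 + c0 * r := by
      refine (norm_sub_le _ _).trans ?_
      rw [norm_one, norm_mul, hc, hr]
    have h2 : ‖s + 1‖ ≤ r + 1 := by
      refine (norm_add_le _ _).trans ?_
      rw [norm_one, hr]
    rw [e]
    refine (norm_add_le _ _).trans ?_
    rw [norm_mul, norm_mul, norm_neg, norm_mul, ← hr, add_mul]
    gcongr
  have hlow : ((r - 1) * (c0 * r - 1) - (r + 2)) * ‖Xi (s + 1)‖ ≤ ‖G s‖ := by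
    have h1 : r - 1 ≤ ‖s - 1‖ := by
      have := norm_sub_norm_le s 1
      rwa [norm_one, ← hr] at this
    have h2 : c0 * r - 1 ≤ ‖c0 * s + (1 - c0)‖ := by
      have h3 := norm_sub_norm_le (c0 * s : ℂ) (-((1 - c0 : ℝ) : ℂ))
      rw [norm_mul, hc, ← hr, norm_neg, norm_real, Real.norm_of_nonneg (by linarith),
        sub_neg_eq_add] at h3
      push_cast at h3
      linarith
    have h3 : ‖s - 2‖ ≤ r + 2 := by
      refine (norm_sub_le _ _).trans ?_
      rw [hr]; simp
    have h4 := norm_sub_norm_le ((s - 1) * (c0 * s + (1 - c0)) * Xi (s + 1)) ((s - 2) * Xi s)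
    refine le_trans ?_ h4
    rw [norm_mul, norm_mul, norm_mul, sub_mul]
    have hcr : 0 ≤ c0 * r - 1 := by nlinarith
    have h5 : (r - 1) * (c0 * r - 1) ≤ ‖s - 1‖ * ‖c0 * s + (1 - c0)‖ := by gcongr
    gcongr
  have hcmp : r * (1 + c0 * r) + (r + 1) ≤ 4 * ((r - 1) * (c0 * r - 1) - (r + 2)) := by
    have h1 : 0 ≤ c0 * r * (r - 1000) :=
      mul_nonneg (mul_nonneg c0_pos.le (by linarith)) (by linarith)
    have h2 : 471975/10000000 * r ≤ c0 * r := by gcongr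
    have h3 : c0 * r ≤ 471976/10000000 * r := by gcongr
    linarith
  calc ‖G (1 - s)‖ ≤ _ := hup
    _ ≤ 4 * ((r - 1) * (c0 * r - 1) - (r + 2)) * ‖Xi (s + 1)‖ := by gcongr
    _ = 4 * (((r - 1) * (c0 * r - 1) - (r + 2)) * ‖Xi (s + 1)‖) := by ring
    _ ≤ _ := by gcongr

lemma Xi_two_mul_ne_zero {s : ℂ} (hs : 1/2 ≤ s.re) : Xi (2 * s) ≠ 0 :=
  Xi_ne_zero (by simp; linarith)

lemma differentiableAt_V {g : ℂ → ℂ} (hgd : Differentiable ℂ g)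
    (hg0 : ∀ s : ℂ, 1/2 ≤ s.re → g s ≠ 0) {s : ℂ} (hs : 1/2 ≤ s.re) :
    DifferentiableAt ℂ (V g) s := by
  have := differentiable_Xi
  exact DifferentiableAt.div (by fun_prop) (by fun_prop)
    (mul_ne_zero (Xi_two_mul_ne_zero hs) (hg0 s hs))

lemma norm_V_le_one {g : ℂ → ℂ} (hgd : Differentiable ℂ g)
    (hg0 : ∀ s : ℂ, 1/2 ≤ s.re → g s ≠ 0) (hgc : ∀ s, g (conj s) = conj (g s))
    (hq : ∃ R : ℝ, ∀ s : ℂ, 1/2 ≤ s.re → R ≤ ‖s‖ →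
      ‖g (1 - s)‖ * ‖G s‖ ≤ 4 * (‖g s‖ * ‖G (1 - s)‖)) {s : ℂ}
    (hs : 1/2 ≤ s.re) : ‖V g s‖ ≤ 1 := by
  obtain ⟨R, hR⟩ := hq
  have hbd : ∀ s : ℂ, 1/2 ≤ s.re → max R 1000 ≤ ‖s‖ → ‖V g s‖ ≤ 16 := by
    intro s hs hsR
    have h1 := hR s hs ((le_max_left _ _).trans hsR)
    have h2 := norm_G_one_sub_le hs ((le_max_right _ _).trans hsR)
    have h3 : ‖g (1 - s)‖ ≤ 16 * ‖g s‖ := by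
      rcases (norm_nonneg (G s)).eq_or_lt with h0 | h0
      · have hG0 : G s = 0 := norm_eq_zero.mp h0.symm
        obtain ⟨a1, a2⟩ := bounds_of_G_eq_zero hs hG0
        have hn : ‖s‖^2 = s.re^2 + s.im^2 := by rw [Complex.sq_norm, normSq_apply]; ring
        have hb := (le_max_right R 1000).trans hsR
        nlinarith
      · refine le_of_mul_le_mul_right ?_ h0
        calc _ ≤ 4 * (‖g s‖ * ‖G (1 - s)‖) := h1
          _ ≤ 4 * (‖g s‖ * (4 * ‖G s‖)) := by gcongr
          _ = _ := by ring
    have h4 : ‖Xi (2 * s - 1)‖ ≤ ‖Xi (2 * s)‖ := by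
      have := norm_Xi_le_norm_Xi_add_one (s := 2 * s - 1) (by simp; linarith)
      rwa [sub_add_cancel] at this
    have h5 : 0 < ‖Xi (2 * s) * g s‖ :=
      norm_pos_iff.mpr (mul_ne_zero (Xi_two_mul_ne_zero hs) (hg0 s hs))
    rw [V, norm_div, div_le_iff₀ h5, norm_mul, norm_mul]
    calc _ ≤ ‖Xi (2 * s)‖ * (16 * ‖g s‖) := by gcongr
      _ = _ := by ring
  refine norm_le_one_of_re_half (fun z hz => differentiableAt_V hgd hg0 hz)
    ⟨16, 0, max R 1000, fun z hz hzR => ?_⟩ ⟨16, max R 1000, fun x hx => ?_⟩ (fun z hz => ?_) hs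
  · simpa using hbd z hz.le hzR
  · have h0 : 1000 ≤ x := (le_max_right _ _).trans hx
    refine hbd x (by rw [ofReal_re]; linarith) ?_
    rwa [norm_real, Real.norm_of_nonneg (by linarith)]
  · have e1 : conj z = 1 - z := by
      apply Complex.ext
      · simp [hz]; norm_num
      · simp
    have e2 : ‖Xi (2 * z - 1)‖ = ‖Xi (2 * z)‖ := by
      have h2 : (conj (2 : ℂ)) = 2 := Complex.conj_ofNat 2
      rw [← norm_Xi_conj (2 * z), ← Xi_one_sub (2 * z - 1), map_mul, e1, h2]
      congr 2
      ring
    have e3 : ‖g (1 - z)‖ = ‖g z‖ := by rw [← e1, hgc, RCLike.norm_conj]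
    have h5 : 0 < ‖Xi (2 * z) * g z‖ :=
      norm_pos_iff.mpr (mul_ne_zero (Xi_two_mul_ne_zero hz.ge) (hg0 z hz.ge))
    rw [V, norm_div, div_le_one h5, norm_mul, norm_mul, e2, e3]

lemma J_two_eq : J 2 = c0 / 2 := by rw [J_two, c0]

lemma hasDerivAt_J (x : ℝ) :
    ∃ y : ℝ, HasDerivAt J y x ∧ HasDerivAt completedRiemannZeta₀ (y : ℂ) x := by
  have h := (differentiable_completedZeta₀ (x : ℂ)).hasDerivAt
  have h1 := h.real_of_complex
  have h2 := h.comp_ofReal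
  have h3 := h1.ofReal_comp
  have e : (fun y : ℝ => completedRiemannZeta₀ y) = fun y : ℝ => ((completedRiemannZeta₀ y).re : ℂ) := by
    ext y; exact completedRiemannZeta₀_ofReal y
  rw [e] at h2
  refine ⟨_, h1, ?_⟩
  rw [h3.unique h2]
  exact h

lemma hasDerivAt_Xi_half : HasDerivAt Xi 0 (1/2) := by
  have h1 := (differentiable_Xi (1/2)).hasDerivAt
  have h2 : HasDerivAt Xi (deriv Xi (1/2)) (1 - 1/2) := by
    rw [show (1 - 1/2 : ℂ) = 1/2 by norm_num]; exact h1
  have h3 := h2.comp (1/2 : ℂ) ((hasDerivAt_id (1/2 : ℂ)).const_sub 1)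
  have h4 : HasDerivAt Xi (deriv Xi (1/2) * -1) (1/2) :=
    h3.congr_of_eventuallyEq (.of_forall fun s => (Xi_one_sub s).symm)
  have h5 := h1.unique h4
  have h6 : deriv Xi (1/2) = 0 := by linear_combination h5 / 2
  rwa [h6] at h1

/-- The values of `G` and of its derivative at `1 / 2`. -/
lemma exists_hasDerivAt_G_half : ∃ u v : ℝ, G (1/2) = u ∧ HasDerivAt G (v : ℂ) (1/2) ∧
    0 < u ∧ 2 * J 1 * u + v < 0 := by
  obtain ⟨y, hJ, hz⟩ := hasDerivAt_J (3/2)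
  have hy : 0 ≤ y := by
    refine ge_of_tendsto ((hasDerivAt_iff_tendsto_slope.mp hJ).mono_left
      (nhdsWithin_mono _ (fun x hx => ne_of_gt hx) : nhdsWithin (3/2 : ℝ) (Set.Ioi (3/2)) ≤ _)) ?_
    filter_upwards [self_mem_nhdsWithin] with x hx
    have hx' : (3/2 : ℝ) < x := hx
    rw [slope_def_field]
    exact div_nonneg (sub_nonneg.mpr (J_mono (by norm_num) hx'.le)) (by linarith)
  have hX32 : Xi (1/2 + 1) = ((1 + 3/4 * J (3/2) : ℝ) : ℂ) := by
    rw [show (1/2 + 1 : ℂ) = ((3/2 : ℝ) : ℂ) by push_cast; norm_num, Xi_ofReal, XiR]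
    congr 1; ring
  have hX12 : Xi (1/2) = ((1 - 1/4 * J (1/2) : ℝ) : ℂ) := by
    rw [show (1/2 : ℂ) = ((1/2 : ℝ) : ℂ) by push_cast; norm_num, Xi_ofReal, XiR]
    congr 1; ring
  have hd32 : HasDerivAt Xi ((2 * J (3/2) + 3/4 * y : ℝ) : ℂ) (1/2 + 1) := by
    have e : (1/2 + 1 : ℂ) = ((3/2 : ℝ) : ℂ) := by push_cast; norm_num
    rw [e]
    have h := ((((hasDerivAt_id ((3/2 : ℝ) : ℂ)).mul
      ((hasDerivAt_id ((3/2 : ℝ) : ℂ)).sub_const 1))).mul hz).add_const 1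
    refine h.congr_deriv ?_
    have := completedRiemannZeta₀_ofReal (3/2)
    simp only [this, id]
    push_cast
    simp
    ring
  have hdG : HasDerivAt G (((1 - c0) * (1 + 3/4 * J (3/2)) -
      1/2 * (1 - c0/2) * (2 * J (3/2) + 3/4 * y) - (1 - 1/4 * J (1/2)) : ℝ) : ℂ) (1/2) := by
    have h1 := hd32.comp (1/2 : ℂ) ((hasDerivAt_id (1/2 : ℂ)).add_const 1)
    have h2 := (((hasDerivAt_id (1/2 : ℂ)).sub_const 1).mul
      (((hasDerivAt_id (1/2 : ℂ)).const_mul (c0 : ℂ)).add_const (1 - c0 : ℂ))).mul h1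
    have h3 := h2.sub (((hasDerivAt_id (1/2 : ℂ)).sub_const 2).mul hasDerivAt_Xi_half)
    refine (h3.congr_of_eventuallyEq (.of_forall fun s => ?_)).congr_deriv ?_
    · simp [G]
    · simp only [Function.comp_apply, id, hX32, hX12, Pi.mul_apply]
      push_cast
      ring
  refine ⟨-(1/2) * (1 - c0/2) * (1 + 3/4 * J (3/2)) + 3/2 * (1 - 1/4 * J (1/2)), _, ?_, hdG, ?_⟩
  · rw [G, hX32, hX12]
    push_cast
    ring
  have a1 : J (1/2) ≤ J (3/2) := J_mono (by norm_num) (by norm_num)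
  have a2 : J 1 ≤ J (3/2) := J_mono (by norm_num) (by norm_num)
  have a3 : J (3/2) ≤ c0 / 2 := by rw [← J_two_eq]; exact J_mono (by norm_num) (by norm_num)
  have a4 : 0 ≤ J (1/2) := J_nonneg _
  have a5 := J_one_pos
  have c1 := c0_gt
  have c2 := c0_lt
  have cp := c0_pos
  have a6 : 45/100 * c0 ≤ J 1 := by
    have h1 := one_div_J_one
    have h2 := eps_nonneg
    have h3 : 1 / J 1 ≤ 1 + 2 / c0 := by linarith
    rw [div_le_iff₀ a5] at h3
    have h4 : (1 + 2 / c0) * J 1 * c0 = (c0 + 2) * J 1 := by field_simp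
    nlinarith
  generalize J 1 = k at *
  generalize J (1/2) = m at *
  generalize J (3/2) = i at *
  constructor
  · nlinarith
  · have b1 : 3/4 * k * (1 - c0/2) * k ≤ 3/4 * k * (1 - c0/2) * i := by
      have : 0 ≤ 1 - c0/2 := by linarith
      gcongr
    have b2 : c0 * k ≤ c0 * i := by gcongr
    have b3 : 0 ≤ k * m := by positivity
    have b4 : 0 ≤ y * (1 - c0/2) := mul_nonneg hy (by linarith)
    have b5 : c0 / 4 < 3/4 * (1 - c0/2) * k := by nlinarith
    have b6 : k * (c0 / 4) < k * (3/4 * (1 - c0/2) * k) := by gcongr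
    linarith

lemma V_half {g : ℂ → ℂ} (h0 : g (1/2) ≠ 0) : V g (1/2) = 1 := by
  rw [V, mul_one_div_cancel two_ne_zero, sub_self, Xi_zero, Xi_one,
    show (1 - 1/2 : ℂ) = 1/2 by norm_num, div_self (mul_ne_zero one_ne_zero h0)]

lemma hasDerivAt_V_half {g : ℂ → ℂ} {r : ℝ} (h0 : g (1/2) ≠ 0)
    (hg : HasDerivAt g (r * g (1/2)) (1/2)) :
    HasDerivAt (V g) ((-2 * (2 * J 1 + r) : ℝ) : ℂ) (1/2) := by
  have e1 : (2 * (1/2) : ℂ) = 1 := by norm_num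
  have e0 : (2 * (1/2) - 1 : ℂ) = 0 := by norm_num
  have eh : (1 - 1/2 : ℂ) = 1/2 := by norm_num
  have hi := hasDerivAt_id (1/2 : ℂ)
  have h1 : HasDerivAt (fun s => Xi (2 * s - 1)) (-J 1 * (2 * 1) : ℂ) (1/2) := by
    have h4 : HasDerivAt Xi (-J 1) (2 * (1/2) - 1) := by rw [e0]; exact hasDerivAt_Xi_zero
    exact HasDerivAt.comp (1/2 : ℂ) h4 ((hi.const_mul 2).sub_const 1)
  have h2 : HasDerivAt (fun s => Xi (2 * s)) (J 1 * (2 * 1) : ℂ) (1/2) := by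
    have h4 : HasDerivAt Xi (J 1) (2 * (1/2)) := by rw [e1]; exact hasDerivAt_Xi_one
    exact HasDerivAt.comp (1/2 : ℂ) h4 (hi.const_mul 2)
  have h3 : HasDerivAt (fun s => g (1 - s)) (r * g (1/2) * -1) (1/2) := by
    have h4 : HasDerivAt g (r * g (1/2)) (1 - 1/2) := by rw [eh]; exact hg
    exact HasDerivAt.comp (1/2 : ℂ) h4 (hi.const_sub 1)
  have hne : Xi (2 * (1/2)) * g (1/2) ≠ 0 := by
    rw [e1, Xi_one, one_mul]; exact h0
  refine ((h1.mul h3).div (h2.mul hg) hne).congr_deriv ?_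
  simp only [Pi.mul_apply, e1, sub_self, eh, Xi_one, Xi_zero]
  push_cast
  field_simp
  ring

/-- A function bounded by one on the half-plane and equal to one at the boundary point
`1 / 2` cannot increase there. -/
lemma deriv_nonpos_of_norm_le_one {f : ℂ → ℂ} {y : ℝ} (hd : HasDerivAt f (y : ℂ) (1/2))
    (h1 : f (1/2) = 1) (hf : ∀ s : ℂ, 1/2 ≤ s.re → ‖f s‖ ≤ 1) : y ≤ 0 := by
  have h2 : HasDerivAt f (y : ℂ) ((1/2 : ℝ) : ℂ) := by
    rw [show ((1/2 : ℝ) : ℂ) = 1/2 by push_cast; rfl]; exact hd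
  have h3 := h2.real_of_complex
  rw [ofReal_re] at h3
  refine le_of_tendsto ((hasDerivAt_iff_tendsto_slope.mp h3).mono_left
    (nhdsWithin_mono _ (fun x hx => ne_of_gt hx) : nhdsWithin (1/2 : ℝ) (Set.Ioi (1/2)) ≤ _)) ?_
  filter_upwards [self_mem_nhdsWithin] with x hx
  have hlt : (1/2 : ℝ) < x := hx
  rw [slope_def_field]
  refine div_nonpos_of_nonpos_of_nonneg (sub_nonpos.mpr ?_) (by linarith)
  have e : f ((1/2 : ℝ) : ℂ) = 1 := by
    rw [show ((1/2 : ℝ) : ℂ) = 1/2 by push_cast; rfl]; exact h1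
  rw [e, one_re]
  exact (Complex.re_le_norm _).trans (hf x (by rw [ofReal_re]; exact hlt.le))

/-- The numerator of `wengSp4P1`. -/
noncomputable def N (s : ℂ) : ℂ := Xi (2 * s) * G s - Xi (2 * s - 1) * G (1 - s)

lemma N_one_sub (s : ℂ) : N (1 - s) = -N s := by
  rw [N, N, ← Xi_one_sub (2 * s), ← Xi_one_sub (2 * s - 1), sub_sub_cancel,
    show 2 * (1 - s) - 1 = 1 - 2 * s by ring, show 1 - (2 * s - 1) = 2 * (1 - s) by ring]
  ring

lemma N_one : N 1 = 0 := by
  have h : ((Real.pi / 3 : ℝ) : ℂ) = 1 + c0 := by rw [c0]; push_cast; ring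
  rw [N, G, G, mul_one, sub_self, zero_add, Xi_zero, Xi_one, Xi_two, h,
    show (2 - 1 : ℂ) = 1 by norm_num, Xi_one]
  ring

lemma V_eq_div {g : ℂ → ℂ} {p s : ℂ} {a M : ℝ} (ha : p.re = 1/2 + a)
    (hM : M = a^2 + p.im^2) (ha0 : 0 < a) (hg0 : ∀ s : ℂ, 1/2 ≤ s.re → g s ≠ 0)
    (hG : ∀ s, G s = (s - p) * (s - conj p) * g s) (hs : 1/2 < s.re) (hN : N s = 0) :
    V g s ≠ 1 ∧ (1 + V g s) / (1 - V g s) =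
      (1 / (2 * a) : ℝ) * (s - 1/2) + (M / (2 * a) : ℝ) / (s - 1/2) := by
  obtain ⟨w, hw⟩ : ∃ w, w = s - 1/2 := ⟨_, rfl⟩
  have hp : p = 1/2 + a + p.im * I := by
    apply Complex.ext
    · simp [ha]
    · simp
  have hpc : conj p = 1/2 + a - p.im * I := by
    apply Complex.ext
    · simp [ha]
    · simp
  have hI : (I : ℂ)^2 = -1 := I_sq
  have q1 : (s - p) * (s - conj p) = w^2 - 2 * a * w + M := by
    rw [hpc, hM, hw]
    nth_rewrite 1 [hp]
    push_cast
    linear_combination -(p.im : ℂ)^2 * hI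
  have q2 : (1 - s - p) * (1 - s - conj p) = w^2 + 2 * a * w + M := by
    rw [hpc, hM, hw]
    nth_rewrite 1 [hp]
    push_cast
    linear_combination -(p.im : ℂ)^2 * hI
  have hw0 : w ≠ 0 := by
    intro h0
    have h1 : s = 1/2 := by rw [h0] at hw; linear_combination -hw
    rw [h1] at hs
    norm_num at hs
  have ha' : (a : ℂ) ≠ 0 := by exact_mod_cast ha0.ne'
  have hX := Xi_two_mul_ne_zero hs.le
  have hgs := hg0 s hs.le
  have hV : (w^2 + 2 * a * w + M) * V g s = w^2 - 2 * a * w + M := by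
    rw [N, hG s, hG (1 - s), q1, q2] at hN
    rw [V, ← mul_div_assoc, div_eq_iff (mul_ne_zero hX hgs)]
    linear_combination -hN
  have hq : w^2 + 2 * a * w + M ≠ 0 := by
    intro h0
    rw [h0, zero_mul] at hV
    have : 4 * (a * w) = 0 := by linear_combination h0 + hV
    simp [ha', hw0] at this
  have hV' : V g s = (w^2 - 2 * a * w + M) / (w^2 + 2 * a * w + M) := by
    rw [eq_div_iff hq, ← hV]; ring
  have h1 : 1 - V g s = 4 * a * w / (w^2 + 2 * a * w + M) := by
    rw [hV', one_sub_div hq]; congr 1; ring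
  have h2 : 1 + V g s = 2 * (w^2 + M) / (w^2 + 2 * a * w + M) := by
    rw [hV', one_add_div hq]; congr 1; ring
  constructor
  · intro h
    rw [h, sub_self] at h1
    exact div_ne_zero (mul_ne_zero (mul_ne_zero (by norm_num : (4 : ℂ) ≠ 0) ha') hw0) hq h1.symm
  · rw [h1, h2, div_div_div_cancel_right₀ hq, ← hw]
    push_cast
    field_simp
    ring

lemma eq_of_schwarz_pick {X : ℂ → ℂ} {b η : ℝ} (hb : 0 < b) (hη : 0 < η) {z w : ℂ} {x : ℝ}
    (hx : z = x) (hz : 0 < z.re) (hw : 0 < w.re)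
    (h : ‖X z - X w‖ * ‖z + conj w‖ ≤ ‖z - w‖ * ‖X z + conj (X w)‖)
    (hXz : X z = b * z - η / z) (hXw : X w = b * w - η / w) : z = w := by
  by_contra hne
  have z0 : z ≠ 0 := by rintro rfl; simp at hz
  have w0 : w ≠ 0 := by rintro rfl; simp at hw
  have hzc : conj z = z := by rw [hx, conj_ofReal]
  have hwc : conj w ≠ 0 := (map_ne_zero _).mpr w0
  have e1 : X z - X w = (z - w) * (b + η / (z * w)) := by
    rw [hXz, hXw]; field_simp; ring
  have e2 : X z + conj (X w) = (z + conj w) * conj (b - η / (z * w)) := by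
    rw [hXz, hXw]
    simp only [map_sub, map_mul, map_div₀, conj_ofReal, hzc]
    field_simp
    ring
  rw [e1, e2, norm_mul, norm_mul, RCLike.norm_conj] at h
  have n1 : 0 < ‖z - w‖ := norm_pos_iff.mpr (sub_ne_zero.mpr hne)
  have n2 : 0 < ‖z + conj w‖ := by
    refine lt_of_lt_of_le ?_ (Complex.re_le_norm _)
    simp only [add_re, conj_re]
    linarith
  have h1 : ‖b + η / (z * w)‖ ≤ ‖b - η / (z * w)‖ := by
    refine le_of_mul_le_mul_left ?_ (mul_pos n1 n2)
    linarith
  have h2 := pow_le_pow_left₀ (norm_nonneg _) h1 2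
  rw [Complex.sq_norm, Complex.sq_norm, normSq_apply, normSq_apply] at h2
  simp only [add_re, sub_re, add_im, sub_im, ofReal_re, ofReal_im] at h2
  have h3 : b * (η / (z * w) : ℂ).re ≤ 0 := by linarith
  have h4 : 0 < (η / (z * w) : ℂ).re := by
    rw [hx] at hz ⊢
    rw [ofReal_re] at hz
    rw [← div_div, ← ofReal_div, div_re, ofReal_re, ofReal_im, zero_mul, zero_div, add_zero]
    exact div_pos (mul_pos (div_pos hη hz) hw) (normSq_pos.mpr w0)
  nlinarith [mul_pos hb h4]

lemma eq_one_of_N_eq_zero {s : ℂ} (hs : 1/2 < s.re) (hN : N s = 0) : s = 1 := by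
  obtain ⟨g, hgd, hg0, hgc, hcase⟩ := exists_G_eq_mul
  obtain ⟨u, v, hu, hv, hu0, huv⟩ := exists_hasDerivAt_G_half
  have hgh : g (1/2) ≠ 0 := hg0 _ (by norm_num)
  have huC : (u : ℂ) ≠ 0 := by exact_mod_cast hu0.ne'
  have hneg : 2 * J 1 + v / u < 0 := by
    have : 2 * J 1 + v / u = (2 * J 1 * u + v) / u := by field_simp
    rw [this]
    exact div_neg_of_neg_of_pos huv hu0
  rcases hcase with hG | ⟨p, hp, hG⟩
  · exfalso
    have hq : ∀ s : ℂ, 1/2 ≤ s.re → ‖V g s‖ ≤ 1 := fun s hs =>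
      norm_V_le_one hgd hg0 hgc ⟨0, fun s _ _ => by
        rw [← hG, ← hG]
        nlinarith [norm_nonneg (G s), norm_nonneg (G (1 - s)),
          mul_nonneg (norm_nonneg (G s)) (norm_nonneg (G (1 - s)))]⟩ hs
    have hgG : g = G := funext fun s => (hG s).symm
    have hdg : HasDerivAt g (((v / u : ℝ) : ℂ) * g (1/2)) (1/2) := by
      rw [hgG, hu]
      refine hv.congr_deriv ?_
      push_cast
      field_simp
    have := deriv_nonpos_of_norm_le_one (hasDerivAt_V_half hgh hdg) (V_half hgh) hq
    linarith
  obtain ⟨a, ha⟩ : ∃ a : ℝ, p.re = 1/2 + a := ⟨p.re - 1/2, by ring⟩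
  obtain ⟨M, hM⟩ : ∃ M : ℝ, M = a^2 + p.im^2 := ⟨_, rfl⟩
  have ha0 : 0 ≤ a := by linarith
  have hbound : ∀ s : ℂ, 1/2 ≤ s.re → ‖V g s‖ ≤ 1 := by
    refine fun s hs => norm_V_le_one hgd hg0 hgc ⟨1 + 3 * (1 + ‖p‖), fun s _ hsR => ?_⟩ hs
    have hlin : ∀ p' : ℂ, ‖p'‖ = ‖p‖ → ‖s - p'‖ ≤ 2 * ‖1 - s - p'‖ := by
      intro p' hp'
      have h1 := norm_sub_le s p'
      have h2 := norm_sub_norm_le s (1 - p')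
      have h3 := norm_sub_le 1 p'
      rw [norm_one] at h3
      rw [show s - (1 - p') = -(1 - s - p') by ring, norm_neg] at h2
      rw [hp'] at h1 h3
      have := norm_nonneg p
      linarith
    have h1 := hlin p rfl
    have h2 := hlin (conj p) (RCLike.norm_conj p)
    rw [hG s, hG (1 - s), norm_mul, norm_mul, norm_mul, norm_mul]
    have h3 : ‖s - p‖ * ‖s - conj p‖ ≤ (2 * ‖1 - s - p‖) * (2 * ‖1 - s - conj p‖) := by gcongr
    calc ‖g (1 - s)‖ * (‖s - p‖ * ‖s - conj p‖ * ‖g s‖)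
        ≤ ‖g (1 - s)‖ * ((2 * ‖1 - s - p‖) * (2 * ‖1 - s - conj p‖) * ‖g s‖) := by gcongr
      _ = _ := by ring
  have hqh : (1/2 - p) * (1/2 - conj p) = M := by
    rw [hM]
    apply Complex.ext
    · simp [ha, pow_two]
    · simp [pow_two]; ring
  have hMC : (M : ℂ) ≠ 0 := by
    intro h0
    rw [hG, hqh, h0, zero_mul] at hu
    exact huC hu.symm
  have hM0 : 0 < M := by
    have h1 : M ≠ 0 := by exact_mod_cast hMC
    have h2 : 0 ≤ M := by rw [hM]; positivity
    exact h2.lt_of_ne' h1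
  have hdg : HasDerivAt g (((v / u + 2 * a / M : ℝ) : ℂ) * g (1/2)) (1/2) := by
    have hi := hasDerivAt_id (1/2 : ℂ)
    have h1 := (hgd (1/2)).hasDerivAt
    have h2 := ((hi.sub_const p).mul (hi.sub_const (conj p))).mul h1
    have h3 := h2.congr_of_eventuallyEq (f₁ := G) (.of_forall fun s => by simp [hG s])
    have h4 := hv.unique h3
    simp only [Pi.mul_apply, id, one_mul, mul_one] at h4
    rw [hqh] at h4
    have h5 : 1/2 - conj p + (1/2 - p) = -(2 * a : ℂ) := by
      apply Complex.ext
      · simp [ha]; ring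
      · simp
    rw [h5] at h4
    refine h1.congr_deriv ?_
    have h6 : (u : ℂ) = M * g (1/2) := by rw [← hu, hG, hqh]
    have h7 : ((v / u : ℝ) : ℂ) = v / (M * g (1/2)) := by rw [ofReal_div, h6]
    push_cast at h7 ⊢
    rw [h7, h4]
    field_simp
    ring
  have hdV := hasDerivAt_V_half hgh hdg
  have hVh := V_half hgh
  rcases ha0.eq_or_lt with ha0 | ha0
  · exfalso
    have := deriv_nonpos_of_norm_le_one hdV hVh hbound
    rw [← ha0] at this
    norm_num at this
    linarith
  obtain ⟨y, hy⟩ : ∃ y, y = 2 * J 1 + (v / u + 2 * a / M) := ⟨_, rfl⟩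
  obtain ⟨B, hB⟩ : ∃ B : ℂ → ℂ, B = fun w => V g (w + 1/2) := ⟨_, rfl⟩
  have hre : ∀ w : ℂ, 0 < w.re → 1/2 ≤ (w + 1/2).re := fun w hw => by
    simp; linarith
  have hBd : DifferentiableOn ℂ B {w | 0 < w.re} := fun w hw => by
    rw [hB]
    have := differentiableAt_V hgd hg0 (hre w hw)
    exact (this.hasDerivAt.comp_add_const w (1/2)).differentiableAt.differentiableWithinAt
  have hB0 : B 0 = 1 := by simp only [hB, zero_add]; exact hVh
  have hBder : HasDerivAt B (-2 * (y : ℝ) : ℂ) 0 := by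
    rw [hB]
    refine HasDerivAt.comp_add_const 0 (1/2 : ℂ) ?_
    rw [zero_add, hy]
    exact hdV.congr_deriv (by push_cast; ring)
  obtain ⟨h1a, h1b⟩ := V_eq_div ha hM ha0 hg0 hG (s := 1) (by norm_num) N_one
  obtain ⟨h2a, h2b⟩ := V_eq_div ha hM ha0 hg0 hG hs hN
  have hBlt : ∀ w : ℂ, 0 < w.re → ‖B w‖ < 1 := fun w hw => by
    refine norm_lt_one_of_re_pos hBd (fun z hz => ?_) hBder.continuousAt hB0
      (a := 1/2) (by norm_num) ?_ hw
    · rw [hB]; exact hbound _ (hre z hz)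
    · simp only [hB]; rw [add_halves]; exact h1a
  obtain ⟨hy0, hyre⟩ := re_cayley_sub_nonneg hBd hBlt hBder hB0
  have hXd : DifferentiableOn ℂ (fun w => (1 + B w) / (1 - B w) - 1 / (y * w)) {w | 0 < w.re} := by
    intro w hw
    have hw' : 0 < w.re := hw
    have w0 : w ≠ 0 := by rintro rfl; simp at hw'
    have hB1 := hBd w hw
    have hne : 1 - B w ≠ 0 := fun h => by
      have := hBlt w hw'
      rw [← sub_eq_zero.mp h] at this
      simp at this
    have hy1 : (y : ℂ) * w ≠ 0 := mul_ne_zero (by exact_mod_cast hy0.ne') w0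
    exact ((hB1.const_add 1).div (hB1.const_sub 1) hne).sub
      (DifferentiableAt.differentiableWithinAt
        ((differentiableAt_const 1).div (by fun_prop) hy1))
  have hz : 0 < (1/2 : ℂ).re := by norm_num
  have hw : 0 < (s - 1/2).re := by simp; linarith
  have hsp := schwarz_pick hXd hyre hz hw
  have hyC : (y : ℂ) ≠ 0 := by exact_mod_cast hy0.ne'
  have haC : (a : ℂ) ≠ 0 := by exact_mod_cast ha0.ne'
  have hη : 0 < 1 / y - M / (2 * a) := by
    have h1 : y < 2 * a / M := by rw [hy]; linarith
    rw [sub_pos, div_lt_div_iff₀ (by positivity) hy0]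
    rw [lt_div_iff₀ hM0] at h1
    linarith
  have hXform : ∀ z : ℂ, 0 < z.re → (1 + V g z) / (1 - V g z) =
      (1 / (2 * a) : ℝ) * (z - 1/2) + (M / (2 * a) : ℝ) / (z - 1/2) → 0 < (z - 1/2).re →
      (1 + B (z - 1/2)) / (1 - B (z - 1/2)) - 1 / (y * (z - 1/2)) =
      (1 / (2 * a) : ℝ) * (z - 1/2) - ((1 / y - M / (2 * a) : ℝ) : ℂ) / (z - 1/2) := by
    intro z _ h hz
    have hz0 : z - 1/2 ≠ 0 := by intro h; rw [h] at hz; simp at hz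
    simp only [hB]
    rw [sub_add_cancel, h]
    push_cast
    generalize z - 1/2 = w at hz0 ⊢
    field_simp
    ring
  have hX1 := hXform 1 (by simp) h1b (by norm_num)
  have hX2 := hXform s (by linarith) h2b hw
  rw [show (1 - 1/2 : ℂ) = 1/2 by norm_num] at hX1
  have := eq_of_schwarz_pick (X := fun w => (1 + B w) / (1 - B w) - 1 / (y * w))
    (b := 1 / (2 * a)) (by positivity) hη (x := 1/2) (by push_cast; rfl) hz hw hsp hX1 hX2
  linear_combination -this

lemma wengSp4P1_mul_eq (s : ℂ) (hs : s ∉ ({-1, 0, 1/2, 1, 2} : Set ℂ)) :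
    wengSp4P1 s * (4 * s^2 * (2 * s - 1) * (s - 1)^2 * (s - 2) * (s + 1)) = N s := by
  simp only [Set.mem_insert_iff, Set.mem_singleton_iff, not_or] at hs
  obtain ⟨hm1, h0, hh, h1, h2⟩ := hs
  have a1 : s + 1 ≠ 0 := fun h => hm1 (eq_neg_of_add_eq_zero_left h)
  have a2 : s - 1 ≠ 0 := sub_ne_zero.mpr h1
  have a3 : s - 2 ≠ 0 := sub_ne_zero.mpr h2
  have a4 : 2 * s - 1 ≠ 0 := fun h => hh (by linear_combination h / 2)
  have key : ∀ z : ℂ, z ≠ 0 → z - 1 ≠ 0 → completedRiemannZeta z = Xi z / (z * (z - 1)) := by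
    intro z hz hz1
    rw [Xi_eq hz (sub_ne_zero.mp hz1)]
    field_simp
  have x1 := key (s + 1) a1 (by rwa [add_sub_cancel_right])
  have x2 := key (2 * s) (mul_ne_zero two_ne_zero h0) a4
  have x3 := key (s - 1) a2 (by rwa [sub_sub, one_add_one_eq_two])
  have x4 := key (2 * s - 1) a4 (by
    rw [show 2 * s - 1 - 1 = 2 * (s - 1) by ring]; exact mul_ne_zero two_ne_zero a2)
  have x5 := key s h0 a2
  have x6 : completedRiemannZeta 2 = (1 + c0) / 2 := by
    rw [completedRiemannZeta_two, c0]; push_cast; ring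
  have e1 : Xi (1 - s + 1) = Xi (s - 1) := by
    rw [← Xi_one_sub (s - 1)]; congr 1; ring
  rw [add_sub_cancel_right] at x1
  rw [sub_sub, one_add_one_eq_two] at x3
  rw [show 2 * s - 1 - 1 = 2 * (s - 1) by ring] at x4
  rw [wengSp4P1, N, G, G, e1, Xi_one_sub, x1, x2, x3, x4, x5, x6,
    show 2 * s - 2 = 2 * (s - 1) by ring]
  field_simp
  ring

end WengSp4

/-- The Riemann Hypothesis for Weng's `Sp(4)` zeta (Suzuki):
all zeros lie on `Re s = 1/2`. -/
theorem wengSp4P1_riemann_hypothesis (s : ℂ)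
    (hs : s ∉ ({-1, 0, 1/2, 1, 2} : Set ℂ)) (hzero : wengSp4P1 s = 0) :
    s.re = 1/2 := by
  have hN := WengSp4.wengSp4P1_mul_eq s hs
  rw [hzero, zero_mul] at hN
  rcases lt_trichotomy s.re (1/2) with h | h | h
  · exfalso
    have h1 : WengSp4.N (1 - s) = 0 := by rw [WengSp4.N_one_sub, ← hN, neg_zero]
    have h2 := WengSp4.eq_one_of_N_eq_zero (by simp; linarith) h1
    have h3 : s = 0 := by linear_combination -h2
    exact hs (by simp [h3])
  · exact h
  · exact absurd (WengSp4.eq_one_of_N_eq_zero h hN.symm) fun h1 => hs (by simp [h1])
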